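/- arXiv:1712.05560 — 2 statements merged into one kernel-verified Lean document; each statement's English description precedes it below -/
import Mathlib

section
/- Let m and k be integers with m ≥ 5 and 1 ≤ k ≤ 2m+1 such that m(7−m) ≤ 2(k−1) ≤ m(m−3) and the pair of residues (m mod 4, k mod 2) is one of (0,1), (1,0), (2,0), (3,1). Then there exists a k-extended Langford sequence L^k_{4,m}. -/
/-- Existence of a `k`-extended Langford sequence of defect `d` and length `m`:
a partition of `{1, …, 2m+1} \ {k}` into pairs `{aᵢ, aᵢ + i}` for
`i = d, …, d + m - 1` (so the two members of the `i`-th pair differ by `i`). -/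
def ExtLangford (d m k : ℕ) : Prop :=
  ∃ a : ℕ → ℕ,
    ((Finset.Icc d (d + m - 1)).biUnion (fun i => {a i, a i + i}) =
      (Finset.Icc 1 (2 * m + 1)).erase k) ∧
    (∀ i ∈ Finset.Icc d (d + m - 1), ∀ j ∈ Finset.Icc d (d + m - 1), i ≠ j →
      Disjoint ({a i, a i + i} : Finset ℕ) {a j, a j + j})

/-- The differences in `I` partition the set `S`. -/
def DPart (I S : Finset ℕ) : Prop :=
  ∃ a : ℕ → ℕ,
    (I.biUnion (fun i => {a i, a i + i}) = S) ∧
    (∀ i ∈ I, ∀ j ∈ I, i ≠ j →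
      Disjoint ({a i, a i + i} : Finset ℕ) {a j, a j + j})

/-- Pairs with differences `d, …, d+m-1` partition `{1, …, 2m+g}` minus a gap of
length `g` after position `A`. -/
def Outer (d m A g : ℕ) : Prop :=
  DPart (Finset.Icc d (d + m - 1)) (Finset.Icc 1 A ∪ Finset.Icc (A + g + 1) (2 * m + g))

theorem part_of_cover (I S : Finset ℕ) (F : Finset (ℕ × ℕ)) (hF : F.card ≤ I.card)
    (hS : S.card = 2 * I.card) (hI : ∀ i ∈ I, ∃ x, (x, i) ∈ F)
    (hc : ∀ y ∈ S, ∃ e ∈ F, y = e.1 ∨ y = e.1 + e.2) : DPart I S := by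
  have hI' : ∀ i, ∃ x, i ∈ I → (x, i) ∈ F := by
    intro i
    by_cases h : i ∈ I
    · obtain ⟨x, hx⟩ := hI i h
      exact ⟨x, fun _ => hx⟩
    · exact ⟨0, fun h' => absurd h' h⟩
  choose a ha using hI'
  have hG : I.image (fun i => (a i, i)) = F := by
    apply Finset.eq_of_subset_of_card_le
    · intro e he
      obtain ⟨i, hi, rfl⟩ := Finset.mem_image.1 he
      exact ha i hi
    · rw [Finset.card_image_of_injective]
      · exact hF
      · intro i j hij
        exact (Prod.mk.inj hij).2
  have hsub : S ⊆ I.biUnion (fun i => {a i, a i + i}) := by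
    intro y hy
    obtain ⟨e, he, h⟩ := hc y hy
    rw [← hG] at he
    obtain ⟨i, hi, rfl⟩ := Finset.mem_image.1 he
    simp only [Finset.mem_biUnion, Finset.mem_insert, Finset.mem_singleton]
    exact ⟨i, hi, h⟩
  have hcard : (I.biUnion (fun i => ({a i, a i + i} : Finset ℕ))).card ≤ S.card := by
    rw [hS, mul_comm]
    exact Finset.card_biUnion_le_card_mul _ _ _ (fun i _ => Finset.card_le_two)
  have heq := Finset.eq_of_subset_of_card_le hsub hcard
  refine ⟨a, heq.symm, ?_⟩
  let f : ℕ × Bool → ℕ := fun p => if p.2 then a p.1 + p.1 else a p.1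
  have hmaps : ∀ p ∈ I ×ˢ (Finset.univ : Finset Bool), f p ∈ S := by
    rintro ⟨i, b⟩ hp
    rw [Finset.mem_product] at hp
    rw [heq, Finset.mem_biUnion]
    refine ⟨i, hp.1, ?_⟩
    cases b <;> simp [f]
  have hsurj : Set.SurjOn f (I ×ˢ (Finset.univ : Finset Bool) : Finset (ℕ × Bool)) S := by
    intro y hy
    have hy' : y ∈ S := hy
    rw [heq, Finset.mem_biUnion] at hy'
    obtain ⟨i, hi, h⟩ := hy'
    simp only [Finset.mem_insert, Finset.mem_singleton] at h
    rcases h with h | h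
    · exact ⟨(i, false), by simp [hi], by simp [f, h]⟩
    · exact ⟨(i, true), by simp [hi], by simp [f, h]⟩
  have hinj := Finset.injOn_of_surjOn_of_card_le f hmaps hsurj (by
    rw [Finset.card_product, hS]; simp [mul_comm])
  intro i hi j hj hij
  rw [Finset.disjoint_left]
  intro y hyi hyj
  have key : ∀ t ∈ I, y ∈ ({a t, a t + t} : Finset ℕ) → ∃ b, f (t, b) = y := by
    intro t _ h
    simp only [Finset.mem_insert, Finset.mem_singleton] at h
    rcases h with h | h
    · exact ⟨false, by simp [f, h]⟩
    · exact ⟨true, by simp [f, h]⟩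
  obtain ⟨b, hb⟩ := key i hi hyi
  obtain ⟨c, hc'⟩ := key j hj hyj
  have := hinj (x₁ := (i, b)) (by simp [hi]) (x₂ := (j, c)) (by simp [hj]) (hb.trans hc'.symm)
  exact hij (Prod.mk.inj this).1

theorem DPart.union {I J S T : Finset ℕ} (h1 : DPart I S) (h2 : DPart J T)
    (hIJ : Disjoint I J) (hST : Disjoint S T) : DPart (I ∪ J) (S ∪ T) := by
  obtain ⟨a, ha, da⟩ := h1
  obtain ⟨b, hb, db⟩ := h2
  let c : ℕ → ℕ := fun i => if i ∈ I then a i else b i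
  have hcI : ∀ i ∈ I, c i = a i := fun i hi => if_pos hi
  have hcJ : ∀ i ∈ J, c i = b i := fun i hi => if_neg (Finset.disjoint_right.1 hIJ hi)
  have e1 : I.biUnion (fun i => ({c i, c i + i} : Finset ℕ)) = S := by
    rw [← ha]
    exact Finset.biUnion_congr rfl (fun i hi => by rw [hcI i hi])
  have e2 : J.biUnion (fun i => ({c i, c i + i} : Finset ℕ)) = T := by
    rw [← hb]
    exact Finset.biUnion_congr rfl (fun i hi => by rw [hcJ i hi])
  have m1 : ∀ i ∈ I, ({c i, c i + i} : Finset ℕ) ⊆ S := fun i hi => by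
    rw [← e1]
    exact Finset.subset_biUnion_of_mem (fun i => ({c i, c i + i} : Finset ℕ)) hi
  have m2 : ∀ i ∈ J, ({c i, c i + i} : Finset ℕ) ⊆ T := fun i hi => by
    rw [← e2]
    exact Finset.subset_biUnion_of_mem (fun i => ({c i, c i + i} : Finset ℕ)) hi
  refine ⟨c, ?_, ?_⟩
  · rw [Finset.union_biUnion, e1, e2]
  · intro i hi j hj hij
    rcases Finset.mem_union.1 hi with hi | hi <;> rcases Finset.mem_union.1 hj with hj | hj
    · rw [hcI i hi, hcI j hj]
      exact da i hi j hj hij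
    · exact Finset.disjoint_of_subset_left (m1 i hi)
        (Finset.disjoint_of_subset_right (m2 j hj) hST)
    · exact Finset.disjoint_of_subset_left (m2 i hi)
        (Finset.disjoint_of_subset_right (m1 j hj) hST.symm)
    · rw [hcJ i hi, hcJ j hj]
      exact db i hi j hj hij

theorem DPart.shift {I S : Finset ℕ} (A : ℕ) (h : DPart I S) :
    DPart I (S.image (fun x => A + x)) := by
  obtain ⟨a, ha, da⟩ := h
  refine ⟨fun i => A + a i, ?_, ?_⟩
  · rw [← ha, Finset.biUnion_image]
    refine Finset.biUnion_congr rfl (fun i _ => ?_)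
    simp [Finset.image_insert, add_assoc]
  · intro i hi j hj hij
    have := da i hi j hj hij
    simp only [Finset.disjoint_insert_left, Finset.disjoint_insert_right,
      Finset.disjoint_singleton, Finset.disjoint_singleton_left, Finset.mem_insert,
      Finset.mem_singleton] at this ⊢
    omega

theorem ext_iff_part (d m k : ℕ) : ExtLangford d m k ↔
    DPart (Finset.Icc d (d + m - 1)) ((Finset.Icc 1 (2 * m + 1)).erase k) := Iff.rfl

theorem glue {n m' A k d g m : ℕ} (ho : Outer d m' A g) (hd : d = n + 4) (hg : g = 2 * n + 1)
    (hm : m = n + m') (hn : 1 ≤ n) (hm' : 1 ≤ m') (hA : A ≤ 2 * m') (hk : A < k)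
    (hk' : k ≤ A + g) (hi : ExtLangford 4 n (k - A)) : ExtLangford 4 m k := by
  subst hd hg hm
  rw [ext_iff_part] at hi ⊢
  have h := DPart.union (hi.shift A) ho
    (by
      rw [Finset.disjoint_left]
      intro x hx hy
      rw [Finset.mem_Icc] at hx hy
      omega)
    (by
      rw [Finset.disjoint_left]
      intro x hx hy
      simp only [Finset.mem_image, Finset.mem_erase, Finset.mem_union, Finset.mem_Icc] at hx hy
      obtain ⟨y, hy1, hy2⟩ := hx
      omega)
  convert h using 1
  · ext x
    simp only [Finset.mem_union, Finset.mem_Icc]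
    omega
  · ext x
    simp only [Finset.mem_image, Finset.mem_erase, Finset.mem_union, Finset.mem_Icc]
    constructor
    · rintro ⟨h1, h2⟩
      by_cases hx : A < x ∧ x ≤ A + (2 * n + 1)
      · exact Or.inl ⟨x - A, by omega, by omega⟩
      · exact Or.inr (by omega)
    · rintro (⟨y, hy⟩ | hx) <;> omega

theorem of_outer_one {m A k : ℕ} (h : Outer 4 m A 1) (hk : k = A + 1) (hA : A ≤ 2 * m) :
    ExtLangford 4 m k := by
  subst hk
  rw [ext_iff_part]
  unfold Outer at h
  convert h using 1
  ext x
  simp only [Finset.mem_erase, Finset.mem_union, Finset.mem_Icc]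
  omega

theorem reversal {m k k' : ℕ} (h : ExtLangford 4 m k) (hk1 : 1 ≤ k) (hk : k + k' = 2 * m + 2)
    (hk' : 1 ≤ k') : ExtLangford 4 m k' := by
  obtain ⟨a, ha, da⟩ := h
  have hb : ∀ i ∈ Finset.Icc 4 (4 + m - 1), 1 ≤ a i ∧ a i + i ≤ 2 * m + 1 := by
    intro i hi
    have hsub := Finset.subset_biUnion_of_mem (fun i => ({a i, a i + i} : Finset ℕ)) hi
    rw [ha] at hsub
    have h1 := hsub (Finset.mem_insert_self _ _)
    have h2 := hsub (Finset.mem_insert_of_mem (Finset.mem_singleton_self _))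
    simp only [Finset.mem_erase, Finset.mem_Icc] at h1 h2
    omega
  refine ⟨fun i => 2 * m + 2 - (a i + i), ?_, ?_⟩
  · ext x
    have hx := Finset.ext_iff.1 ha (2 * m + 2 - x)
    simp only [Finset.mem_biUnion, Finset.mem_erase, Finset.mem_insert,
      Finset.mem_singleton] at hx ⊢
    constructor
    · rintro ⟨i, hi, h⟩
      have hbi := hb i hi
      have := hx.1 ⟨i, hi, by omega⟩
      rw [Finset.mem_Icc] at this ⊢
      omega
    · rintro ⟨h1, h2⟩
      rw [Finset.mem_Icc] at h2
      obtain ⟨i, hi, h⟩ := hx.2 ⟨by omega, by rw [Finset.mem_Icc]; omega⟩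
      have hbi := hb i hi
      exact ⟨i, hi, by omega⟩
  · intro i hi j hj hij
    have hbi := hb i hi
    have hbj := hb j hj
    have := da i hi j hj hij
    simp only [Finset.disjoint_insert_left, Finset.disjoint_insert_right,
      Finset.disjoint_singleton, Finset.disjoint_singleton_left, Finset.mem_insert,
      Finset.mem_singleton] at this ⊢
    omega

/-- A linear form `c₀ + c₁ s`, stored by its coefficients. -/
abbrev Form := ℕ × ℕ

/-- Value of a form. -/
def ev (f : Form) (s : ℕ) : ℕ := f.1 + f.2 * s

/-- Equality test for forms. -/
def feq (f h : Form) : Bool := Nat.beq f.1 h.1 && Nat.beq f.2 h.2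

/-- Coefficientwise comparison of forms. -/
def fle (f h : Form) : Bool := Nat.ble f.1 h.1 && Nat.ble f.2 h.2

/-- Look up the length of the segment starting at `f`. -/
def look (f : Form) : List (Form × Form) → Option Form
  | [] => none
  | x :: l => bif feq x.1 f then some x.2 else look f l

/-- Segments reachable one after the other from `f` until `hi`; each segment `(start, len)`
covers `start, start + c, …, start + c (len - 1)`. -/
def chain (c : ℕ) (segs : List (Form × Form)) (hi : Form) : ℕ → Form → Bool
  | 0, f => fle hi f
  | n + 1, f => bif fle hi f then true else
      match look f segs with
      | none => false
      | some l => chain c segs hi n (f.1 + c * l.1, f.2 + c * l.2)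

/-- A run of nested pairs: leftmost position, smallest difference, number of pairs. -/
abbrev Run := Form × Form × Form

/-- Segments of positions covered by runs. -/
def psegs : List Run → List (Form × Form)
  | [] => []
  | (p, e, l) :: t =>
      (p, l) :: ((p.1 + (e.1 - 1) + l.1, p.2 + e.2 + l.2), l) :: psegs t

/-- Segments of differences covered by runs. -/
def dsegs : List Run → List (Form × Form)
  | [] => []
  | (_, e, l) :: t => (e, l) :: dsegs t

/-- Total length of runs. -/
def total : List Run → Form
  | [] => (0, 0)
  | (_, _, l) :: t => (l.1 + (total t).1, l.2 + (total t).2)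

/-- All the differences are positive. -/
def dpos : List Run → Bool
  | [] => true
  | (_, e, _) :: t => Nat.ble 1 e.1 && dpos t

/-- The complete check of a parametric family of runs. -/
def check (d m A g : Form) (R : List Run) : Bool :=
  Nat.ble 1 d.1 && fle (total R) m && dpos R && fle A (2 * m.1, 2 * m.2) &&
  chain 1 (psegs R) (A.1 + 1, A.2) (2 * R.length) (1, 0) &&
  chain 1 (psegs R) (2 * m.1 + g.1 + 1, 2 * m.2 + g.2) (2 * R.length)
    (A.1 + g.1 + 1, A.2 + g.2) &&
  chain 2 (dsegs R) (d.1 + m.1, d.2 + m.2) R.length d &&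
  chain 2 (dsegs R) (d.1 + m.1, d.2 + m.2) R.length (d.1 + 1, d.2)

/-- The pairs `(left end, difference)` of a list of runs. -/
def arcs (s : ℕ) : List Run → List (ℕ × ℕ)
  | [] => []
  | (p, e, l) :: t =>
      (List.range (ev l s)).map (fun u => (ev p s + u, ev e s + 2 * (ev l s - 1 - u))) ++ arcs s t

theorem arcs_length (s : ℕ) (R : List Run) : (arcs s R).length = ev (total R) s := by
  induction R with
  | nil => simp [arcs, total, ev]
  | cons x t ih =>
    obtain ⟨p, e, l⟩ := x
    simp only [arcs, total, List.length_append, List.length_map, List.length_range, ih, ev]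
    ring

theorem feq_eq {f h : Form} (H : feq f h = true) : f = h := by
  simp only [feq, Bool.and_eq_true] at H
  exact Prod.ext (Nat.eq_of_beq_eq_true H.1) (Nat.eq_of_beq_eq_true H.2)

theorem fle_ev {f h : Form} (H : fle f h = true) (s : ℕ) : ev f s ≤ ev h s := by
  simp only [fle, Bool.and_eq_true] at H
  exact Nat.add_le_add (Nat.le_of_ble_eq_true H.1)
    (Nat.mul_le_mul_right _ (Nat.le_of_ble_eq_true H.2))

theorem look_mem {f l : Form} {segs : List (Form × Form)} (H : look f segs = some l) :
    (f, l) ∈ segs := by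
  induction segs with
  | nil => simp [look] at H
  | cons x t ih =>
    rw [look] at H
    cases hx : feq x.1 f with
    | true =>
      rw [hx] at H
      simp only [cond_true, Option.some.injEq] at H
      rw [← feq_eq hx, ← H]
      exact List.mem_cons_self
    | false =>
      rw [hx] at H
      exact List.mem_cons_of_mem _ (ih H)

theorem chain_sound {c : ℕ} (hc : 1 ≤ c) {segs : List (Form × Form)} {hi : Form} (s : ℕ) (n : ℕ) :
    ∀ f, chain c segs hi n f = true → ∀ x, ev f s ≤ x → x < ev hi s → (x - ev f s) % c = 0 →
      ∃ q ∈ segs, ∃ u, u < ev q.2 s ∧ x = ev q.1 s + c * u := by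
  induction n with
  | zero =>
    intro f H x h1 h2 _
    have := fle_ev (H : fle hi f = true) s
    omega
  | succ n ih =>
    intro f H x h1 h2 h3
    rw [chain] at H
    cases hf : fle hi f with
    | true =>
      have := fle_ev hf s
      omega
    | false =>
      rw [hf] at H
      simp only [cond_false] at H
      cases hl : look f segs with
      | none => rw [hl] at H; simp at H
      | some l =>
        rw [hl] at H
        have hm := look_mem hl
        have hv : ev (f.1 + c * l.1, f.2 + c * l.2) s = ev f s + c * ev l s := by
          simp only [ev]; ring
        obtain ⟨u, hu⟩ := Nat.dvd_of_mod_eq_zero h3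
        by_cases hul : u < ev l s
        · exact ⟨(f, l), hm, u, hul, by simp only; omega⟩
        · have hle : c * ev l s ≤ c * u := Nat.mul_le_mul_left _ (by omega)
          refine ih _ H x (by rw [hv]; omega) h2 ?_
          rw [hv]
          have : x - (ev f s + c * ev l s) = c * (u - ev l s) := by
            rw [Nat.mul_sub]; omega
          rw [this, Nat.mul_mod_right]

theorem psegs_sound (s : ℕ) (R : List Run) (hR : dpos R = true) :
    ∀ q ∈ psegs R, ∀ u, u < ev q.2 s →
      ∃ e ∈ arcs s R, ev q.1 s + u = e.1 ∨ ev q.1 s + u = e.1 + e.2 := by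
  induction R with
  | nil => intro q hq; simp [psegs] at hq
  | cons x t ih =>
    obtain ⟨p, e, l⟩ := x
    simp only [dpos, Bool.and_eq_true] at hR
    have he := Nat.le_of_ble_eq_true hR.1
    intro q hq u hu
    simp only [psegs, List.mem_cons] at hq
    rcases hq with rfl | rfl | hq
    · refine ⟨(ev p s + u, ev e s + 2 * (ev l s - 1 - u)), ?_, Or.inl rfl⟩
      simp only [arcs, List.mem_append, List.mem_map, List.mem_range]
      exact Or.inl ⟨u, hu, rfl⟩
    · simp only at hu
      refine ⟨(ev p s + (ev l s - 1 - u),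
        ev e s + 2 * (ev l s - 1 - (ev l s - 1 - u))), ?_, Or.inr ?_⟩
      · simp only [arcs, List.mem_append, List.mem_map, List.mem_range]
        exact Or.inl ⟨ev l s - 1 - u, by omega, rfl⟩
      · have : ev (p.1 + (e.1 - 1) + l.1, p.2 + e.2 + l.2) s + 1 = ev p s + ev e s + ev l s := by
          simp only [ev]
          rw [Nat.add_mul, Nat.add_mul]
          omega
        simp only
        omega
    · obtain ⟨w, hw, h⟩ := ih hR.2 q hq u hu
      refine ⟨w, ?_, h⟩
      simp only [arcs, List.mem_append]
      exact Or.inr hw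

theorem dsegs_sound (s : ℕ) (R : List Run) :
    ∀ q ∈ dsegs R, ∀ u, u < ev q.2 s → ∃ x, (x, ev q.1 s + 2 * u) ∈ arcs s R := by
  induction R with
  | nil => intro q hq; simp [dsegs] at hq
  | cons x t ih =>
    obtain ⟨p, e, l⟩ := x
    intro q hq u hu
    simp only [dsegs, List.mem_cons] at hq
    rcases hq with rfl | hq
    · simp only at hu
      refine ⟨ev p s + (ev l s - 1 - u), ?_⟩
      simp only [arcs, List.mem_append, List.mem_map, List.mem_range]
      refine Or.inl ⟨ev l s - 1 - u, by omega, ?_⟩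
      refine Prod.ext rfl ?_
      simp only
      omega
    · obtain ⟨w, hw⟩ := ih q hq u hu
      refine ⟨w, ?_⟩
      simp only [arcs, List.mem_append]
      exact Or.inr hw

theorem sound (d m A g : Form) (R : List Run) (H : check d m A g R = true) (s : ℕ) :
    Outer (ev d s) (ev m s) (ev A s) (ev g s) := by
  simp only [check, Bool.and_eq_true] at H
  obtain ⟨⟨⟨⟨⟨⟨⟨h1, h2⟩, h3⟩, h4⟩, h5⟩, h6⟩, h7⟩, h8⟩ := H
  have hd : 1 ≤ ev d s := by
    have := Nat.le_of_ble_eq_true h1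
    simp only [ev]
    omega
  have hA : ev A s ≤ 2 * ev m s := by
    have h := fle_ev h4 s
    have : ev (2 * m.1, 2 * m.2) s = 2 * ev m s := by simp only [ev]; ring
    omega
  have hT := fle_ev h2 s
  have hcI : (Finset.Icc (ev d s) (ev d s + ev m s - 1)).card = ev m s := by
    rw [Nat.card_Icc]; omega
  have e5 : ev (A.1 + 1, A.2) s = ev A s + 1 := by simp only [ev]; ring
  have e6 : ev (2 * m.1 + g.1 + 1, 2 * m.2 + g.2) s = 2 * ev m s + ev g s + 1 := by
    simp only [ev]; ring
  have e6' : ev (A.1 + g.1 + 1, A.2 + g.2) s = ev A s + ev g s + 1 := by simp only [ev]; ring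
  have e7 : ev (d.1 + m.1, d.2 + m.2) s = ev d s + ev m s := by simp only [ev]; ring
  have e8 : ev (d.1 + 1, d.2) s = ev d s + 1 := by simp only [ev]; ring
  have e1 : ev (1, 0) s = 1 := by simp [ev]
  apply part_of_cover _ _ (arcs s R).toFinset
  · rw [hcI]
    exact (List.toFinset_card_le _).trans ((arcs_length s R).le.trans hT)
  · rw [hcI, Finset.card_union_of_disjoint, Nat.card_Icc, Nat.card_Icc]
    · omega
    · rw [Finset.disjoint_left]
      intro x hx hy
      rw [Finset.mem_Icc] at hx hy
      omega
  · intro i hi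
    rw [Finset.mem_Icc] at hi
    simp only [List.mem_toFinset]
    rcases Nat.mod_two_eq_zero_or_one (i - ev d s) with hp | hp
    · obtain ⟨q, hq, u, hu, rfl⟩ := chain_sound (by norm_num) s _ _ h7 i hi.1
        (by rw [e7]; omega) hp
      exact dsegs_sound s R q hq u hu
    · obtain ⟨q, hq, u, hu, rfl⟩ := chain_sound (by norm_num) s _ _ h8 i (by rw [e8]; omega)
        (by rw [e7]; omega) (by rw [e8]; omega)
      exact dsegs_sound s R q hq u hu
  · intro y hy
    simp only [List.mem_toFinset]
    rw [Finset.mem_union, Finset.mem_Icc, Finset.mem_Icc] at hy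
    rcases hy with hy | hy
    · obtain ⟨q, hq, u, hu, rfl⟩ := chain_sound (le_refl 1) s _ _ h5 y (by rw [e1]; omega)
        (by rw [e5]; omega) (Nat.mod_one _)
      rw [one_mul]
      exact psegs_sound s R h3 q hq u hu
    · obtain ⟨q, hq, u, hu, rfl⟩ := chain_sound (le_refl 1) s _ _ h6 y (by rw [e6']; omega)
        (by rw [e6]; omega) (Nat.mod_one _)
      rw [one_mul]
      exact psegs_sound s R h3 q hq u hu

theorem fam_3_0_7 (s : ℕ) :
    Outer (11 + 1 * s) (21 + 2 * s) (0 + 0 * s) (15 + 2 * s) :=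
  sound (11, 1) (21, 2) (0, 0) (15, 2) [
    ((16, 2), (12, 1), (10, 1)), ((26, 3), (11, 1), (11, 1))]
    rfl s

theorem fam_6_0_8 (s : ℕ) :
    Outer (12 + 2 * s) (24 + 4 * s) (0 + 0 * s) (17 + 4 * s) :=
  sound (12, 2) (24, 4) (0, 0) (17, 4) [
    ((23, 5), (13, 2), (1, 0)), ((29, 6), (24, 4), (1, 0)), ((24, 5), (15, 2), (5, 1)),
    ((18, 4), (26, 4), (5, 1)), ((37, 7), (12, 2), (6, 1)), ((30, 6), (25, 4), (6, 1))]
    rfl s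

theorem fam_6_0_11 (s : ℕ) :
    Outer (12 + 2 * s) (27 + 4 * s) (0 + 0 * s) (17 + 4 * s) :=
  sound (12, 2) (27, 4) (0, 0) (17, 4) [
    ((58, 10), (12, 2), (1, 0)), ((18, 4), (13, 2), (1, 0)), ((37, 7), (14, 2), (1, 0)),
    ((44, 8), (27, 4), (1, 0)), ((25, 5), (15, 2), (6, 1)), ((19, 4), (28, 4), (6, 1)),
    ((38, 7), (16, 2), (6, 1)), ((32, 6), (29, 4), (5, 1))]
    rfl s

theorem fam_6_0_12 (s : ℕ) :
    Outer (12 + 2 * s) (28 + 4 * s) (0 + 0 * s) (17 + 4 * s) :=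
  sound (12, 2) (28, 4) (0, 0) (17, 4) [
    ((19, 4), (13, 2), (1, 0)), ((18, 4), (26, 4), (1, 0)), ((33, 6), (27, 4), (1, 0)),
    ((31, 6), (28, 4), (1, 0)), ((34, 6), (29, 4), (6, 1)), ((40, 7), (18, 2), (4, 1)),
    ((25, 5), (15, 2), (6, 1)), ((20, 4), (30, 4), (5, 1)), ((51, 9), (12, 2), (3, 0))]
    rfl s

theorem fam_6_0_15 (s : ℕ) :
    Outer (12 + 2 * s) (31 + 4 * s) (0 + 0 * s) (17 + 4 * s) :=
  sound (12, 2) (31, 4) (0, 0) (17, 4) [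
    ((44, 7), (12, 2), (1, 0)), ((65, 10), (14, 2), (1, 0)), ((36, 6), (28, 4), (1, 0)),
    ((45, 7), (16, 2), (6, 1)), ((37, 6), (29, 4), (7, 1)), ((28, 5), (19, 2), (5, 1)),
    ((21, 4), (30, 4), (7, 1)), ((18, 4), (13, 2), (3, 0))]
    rfl s

theorem fam_7_4_9 (s : ℕ) :
    Outer (11 + 1 * s) (51 + 6 * s) (33 + 4 * s) (15 + 2 * s) :=
  sound (11, 1) (51, 6) (33, 4) (15, 2) [
    ((27, 3), (22, 3), (1, 0)), ((93, 11), (24, 3), (1, 0)), ((7, 1), (26, 3), (1, 0)),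
    ((12, 1), (12, 1), (5, 1)), ((58, 7), (28, 3), (9, 1)), ((10, 1), (39, 5), (2, 0)),
    ((17, 2), (43, 5), (10, 1)), ((8, 1), (58, 7), (2, 0)), ((1, 0), (46, 5), (6, 1)),
    ((79, 9), (11, 1), (14, 2))]
    rfl s

theorem fam_7_6_9 (s : ℕ) :
    Outer (11 + 1 * s) (51 + 6 * s) (45 + 6 * s) (15 + 2 * s) :=
  sound (11, 1) (51, 6) (45, 6) (15, 2) [
    ((73, 9), (28, 3), (1, 0)), ((31, 4), (40, 5), (1, 0)), ((40, 5), (42, 5), (1, 0)),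
    ((32, 4), (59, 7), (1, 0)), ((12, 2), (60, 7), (1, 0)), ((39, 5), (61, 7), (1, 0)),
    ((83, 10), (12, 1), (8, 1)), ((1, 0), (27, 3), (6, 1)), ((23, 3), (44, 5), (8, 1)),
    ((7, 1), (30, 3), (5, 1)), ((92, 11), (11, 1), (8, 1)), ((13, 2), (39, 5), (10, 1))]
    rfl s

theorem fam_7_4_11 (s : ℕ) :
    Outer (11 + 1 * s) (53 + 6 * s) (32 + 4 * s) (15 + 2 * s) :=
  sound (11, 1) (53, 6) (32, 4) (15, 2) [
    ((24, 3), (26, 3), (1, 0)), ((66, 8), (27, 3), (1, 0)), ((68, 8), (28, 3), (1, 0)),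
    ((23, 3), (30, 3), (1, 0)), ((67, 8), (46, 5), (1, 0)), ((6, 1), (63, 7), (1, 0)),
    ((78, 9), (29, 3), (8, 1)), ((86, 10), (12, 1), (7, 1)), ((59, 7), (32, 3), (7, 1)),
    ((7, 1), (11, 1), (8, 1)), ((48, 6), (45, 5), (2, 0)), ((51, 6), (59, 7), (2, 0)),
    ((15, 2), (48, 5), (8, 1)), ((1, 0), (49, 5), (5, 1))]
    rfl s

theorem fam_7_6_11 (s : ℕ) :
    Outer (11 + 1 * s) (53 + 6 * s) (46 + 6 * s) (15 + 2 * s) :=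
  sound (11, 1) (53, 6) (46, 6) (15, 2) [
    ((6, 1), (27, 3), (1, 0)), ((65, 8), (28, 3), (1, 0)), ((21, 3), (41, 5), (1, 0)),
    ((34, 4), (43, 5), (1, 0)), ((31, 4), (44, 5), (1, 0)), ((76, 9), (45, 5), (1, 0)),
    ((66, 8), (46, 5), (1, 0)), ((32, 4), (62, 7), (1, 0)), ((40, 5), (63, 7), (1, 0)),
    ((24, 3), (48, 5), (7, 1)), ((13, 2), (47, 5), (8, 1)), ((85, 10), (12, 1), (8, 1)),
    ((95, 11), (11, 1), (8, 1)), ((7, 1), (29, 3), (6, 1)), ((22, 3), (40, 5), (2, 0)),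
    ((1, 0), (30, 3), (5, 1))]
    rfl s

theorem fam_7_4_13 (s : ℕ) :
    Outer (11 + 1 * s) (55 + 6 * s) (33 + 4 * s) (15 + 2 * s) :=
  sound (11, 1) (55, 6) (33, 4) (15, 2) [
    ((25, 3), (27, 3), (1, 0)), ((22, 3), (28, 3), (1, 0)), ((51, 6), (45, 5), (1, 0)),
    ((6, 1), (47, 5), (1, 0)), ((49, 6), (48, 5), (1, 0)), ((54, 6), (60, 7), (1, 0)),
    ((1, 0), (50, 5), (5, 1)), ((77, 9), (30, 3), (9, 1)), ((88, 10), (11, 1), (8, 1)),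
    ((23, 3), (62, 7), (2, 0)), ((60, 7), (63, 7), (2, 0)), ((7, 1), (12, 1), (8, 1)),
    ((15, 2), (49, 5), (7, 1)), ((62, 7), (29, 3), (8, 1))]
    rfl s

theorem fam_7_6_13 (s : ℕ) :
    Outer (11 + 1 * s) (55 + 6 * s) (47 + 6 * s) (15 + 2 * s) :=
  sound (11, 1) (55, 6) (47, 6) (15, 2) [
    ((20, 3), (27, 3), (1, 0)), ((7, 1), (28, 3), (1, 0)), ((88, 10), (29, 3), (1, 0)),
    ((67, 8), (30, 3), (1, 0)), ((36, 4), (43, 5), (1, 0)), ((34, 4), (46, 5), (1, 0)),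
    ((68, 8), (48, 5), (1, 0)), ((66, 8), (49, 5), (1, 0)), ((33, 4), (65, 7), (1, 0)),
    ((8, 1), (32, 3), (4, 1)), ((24, 3), (51, 5), (7, 1)), ((89, 10), (11, 1), (8, 1)),
    ((99, 11), (12, 1), (8, 1)), ((1, 0), (31, 3), (6, 1)), ((31, 4), (45, 5), (2, 0)),
    ((12, 2), (50, 5), (8, 1)), ((21, 3), (40, 5), (3, 0))]
    rfl s

theorem fam_7_4_15 (s : ℕ) :
    Outer (11 + 1 * s) (57 + 6 * s) (36 + 4 * s) (15 + 2 * s) :=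
  sound (11, 1) (57, 6) (36, 4) (15, 2) [
    ((26, 3), (27, 3), (1, 0)), ((27, 3), (29, 3), (1, 0)), ((52, 6), (48, 5), (1, 0)),
    ((7, 1), (67, 7), (1, 0)), ((84, 9), (31, 3), (8, 1)), ((72, 8), (47, 5), (2, 0)),
    ((1, 0), (51, 5), (6, 1)), ((54, 6), (63, 7), (2, 0)), ((17, 2), (50, 5), (9, 1)),
    ((8, 1), (12, 1), (9, 1)), ((92, 10), (11, 1), (8, 1)), ((63, 7), (30, 3), (9, 1))]
    rfl s

theorem fam_7_6_15 (s : ℕ) :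
    Outer (11 + 1 * s) (57 + 6 * s) (50 + 6 * s) (15 + 2 * s) :=
  sound (11, 1) (57, 6) (50, 6) (15, 2) [
    ((66, 8), (12, 1), (1, 0)), ((99, 11), (30, 3), (1, 0)), ((34, 4), (43, 5), (1, 0)),
    ((32, 4), (44, 5), (1, 0)), ((33, 4), (46, 5), (1, 0)), ((80, 9), (48, 5), (1, 0)),
    ((35, 4), (63, 7), (1, 0)), ((8, 1), (32, 3), (6, 1)), ((100, 11), (11, 1), (9, 1)),
    ((90, 10), (14, 1), (8, 1)), ((1, 0), (29, 3), (7, 1)), ((43, 5), (65, 7), (2, 0)),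
    ((23, 3), (50, 5), (9, 1)), ((14, 2), (45, 5), (9, 1))]
    rfl s

theorem fam_7_4_17 (s : ℕ) :
    Outer (11 + 1 * s) (59 + 6 * s) (37 + 4 * s) (15 + 2 * s) :=
  sound (11, 1) (59, 6) (37, 4) (15, 2) [
    ((113, 12), (11, 1), (1, 0)), ((9, 1), (46, 5), (1, 0)), ((56, 6), (48, 5), (1, 0)),
    ((53, 6), (50, 5), (1, 0)), ((57, 6), (68, 7), (1, 0)), ((54, 6), (69, 7), (1, 0)),
    ((10, 1), (13, 1), (8, 1)), ((94, 10), (12, 1), (9, 1)), ((28, 3), (29, 3), (2, 0)),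
    ((68, 7), (30, 3), (8, 1)), ((86, 9), (33, 3), (8, 1)), ((1, 0), (52, 5), (8, 1)),
    ((18, 2), (49, 5), (10, 1))]
    rfl s

theorem fam_7_6_17 (s : ℕ) :
    Outer (11 + 1 * s) (59 + 6 * s) (51 + 6 * s) (15 + 2 * s) :=
  sound (11, 1) (59, 6) (51, 6) (15, 2) [
    ((122, 13), (11, 1), (1, 0)), ((45, 5), (27, 3), (1, 0)), ((69, 8), (32, 3), (1, 0)),
    ((36, 4), (45, 5), (1, 0)), ((33, 4), (47, 5), (1, 0)), ((46, 5), (66, 7), (1, 0)),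
    ((14, 2), (68, 7), (1, 0)), ((94, 10), (13, 1), (7, 1)), ((15, 2), (52, 5), (7, 1)),
    ((102, 11), (12, 1), (10, 1)), ((22, 3), (44, 5), (2, 0)), ((34, 4), (48, 5), (2, 0)),
    ((70, 8), (49, 5), (2, 0)), ((24, 3), (53, 5), (9, 1)), ((9, 1), (34, 3), (5, 1)),
    ((1, 0), (29, 3), (8, 1))]
    rfl s

theorem fam_7_4_19 (s : ℕ) :
    Outer (11 + 1 * s) (61 + 6 * s) (38 + 4 * s) (15 + 2 * s) :=
  sound (11, 1) (61, 6) (38, 4) (15, 2) [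
    ((19, 2), (45, 5), (1, 0)), ((9, 1), (46, 5), (1, 0)), ((7, 1), (47, 5), (1, 0)),
    ((58, 6), (48, 5), (1, 0)), ((8, 1), (49, 5), (1, 0)), ((56, 6), (51, 5), (1, 0)),
    ((1, 0), (67, 7), (1, 0)), ((65, 7), (70, 7), (1, 0)), ((2, 0), (53, 5), (5, 1)),
    ((10, 1), (12, 1), (9, 1)), ((71, 7), (30, 3), (8, 1)), ((20, 2), (50, 5), (10, 1)),
    ((69, 7), (63, 7), (2, 0)), ((66, 7), (69, 7), (2, 0)), ((89, 9), (11, 1), (17, 2))]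
    rfl s

theorem fam_7_6_19 (s : ℕ) :
    Outer (11 + 1 * s) (61 + 6 * s) (52 + 6 * s) (15 + 2 * s) :=
  sound (11, 1) (61, 6) (52, 6) (15, 2) [
    ((126, 13), (11, 1), (1, 0)), ((70, 8), (13, 1), (1, 0)), ((72, 8), (31, 3), (1, 0)),
    ((37, 4), (44, 5), (1, 0)), ((23, 3), (46, 5), (1, 0)), ((21, 3), (47, 5), (1, 0)),
    ((34, 4), (48, 5), (1, 0)), ((22, 3), (49, 5), (1, 0)), ((44, 5), (50, 5), (1, 0)),
    ((73, 8), (52, 5), (1, 0)), ((45, 5), (71, 7), (1, 0)), ((7, 1), (33, 3), (7, 1)),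
    ((95, 10), (15, 1), (8, 1)), ((14, 2), (54, 5), (7, 1)), ((1, 0), (32, 3), (6, 1)),
    ((35, 4), (68, 7), (2, 0)), ((106, 11), (12, 1), (10, 1)), ((24, 3), (51, 5), (10, 1))]
    rfl s

theorem fam_7_4_21 (s : ℕ) :
    Outer (11 + 1 * s) (63 + 6 * s) (41 + 4 * s) (15 + 2 * s) :=
  sound (11, 1) (63, 6) (41, 4) (15, 2) [
    ((121, 12), (11, 1), (1, 0)), ((70, 7), (12, 1), (1, 0)), ((81, 8), (28, 3), (1, 0)),
    ((30, 3), (30, 3), (1, 0)), ((19, 2), (50, 5), (1, 0)), ((80, 8), (51, 5), (1, 0)),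
    ((59, 6), (52, 5), (1, 0)), ((41, 4), (69, 7), (1, 0)), ((93, 9), (32, 3), (9, 1)),
    ((9, 1), (13, 1), (10, 1)), ((71, 7), (33, 3), (9, 1)), ((1, 0), (53, 5), (8, 1)),
    ((57, 6), (71, 7), (2, 0)), ((102, 10), (14, 1), (7, 1)), ((20, 2), (54, 5), (10, 1))]
    rfl s

theorem fam_7_6_21 (s : ℕ) :
    Outer (11 + 1 * s) (63 + 6 * s) (55 + 6 * s) (15 + 2 * s) :=
  sound (11, 1) (63, 6) (55, 6) (15, 2) [
    ((39, 4), (11, 1), (1, 0)), ((40, 4), (12, 1), (1, 0)), ((49, 5), (31, 3), (1, 0)),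
    ((51, 5), (48, 5), (1, 0)), ((73, 8), (49, 5), (1, 0)), ((25, 3), (50, 5), (1, 0)),
    ((74, 8), (52, 5), (1, 0)), ((71, 8), (54, 5), (1, 0)), ((72, 8), (55, 5), (1, 0)),
    ((1, 0), (33, 3), (8, 1)), ((26, 3), (56, 5), (9, 1)), ((16, 2), (57, 5), (9, 1)),
    ((100, 10), (13, 1), (5, 1)), ((78, 8), (44, 5), (2, 0)), ((76, 8), (51, 5), (2, 0)),
    ((9, 1), (23, 3), (4, 0)), ((13, 1), (38, 3), (3, 1)), ((105, 11), (14, 1), (12, 1))]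
    rfl s

/-- Bit mask of the positions used when the left ends of the pairs with differences
`d, d+1, …` are listed. -/
def cov : ℕ → List ℕ → ℕ
  | _, [] => 0
  | d, a :: t => Nat.lor (Nat.lor (2 ^ a) (2 ^ (a + d))) (cov (d + 1) t)

/-- The listed pairs `(left end, difference)`. -/
def arcsOf : ℕ → List ℕ → List (ℕ × ℕ)
  | _, [] => []
  | d, a :: t => (a, d) :: arcsOf (d + 1) t

theorem arcsOf_length (w : List ℕ) : ∀ d, (arcsOf d w).length = w.length := by
  induction w with
  | nil => intro d; rfl
  | cons a t ih => intro d; simp [arcsOf, ih]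

theorem arcsOf_mem (w : List ℕ) : ∀ d i, d ≤ i → i < d + w.length → ∃ x, (x, i) ∈ arcsOf d w := by
  induction w with
  | nil => intro d i h1 h2; simp at h2; omega
  | cons a t ih =>
    intro d i h1 h2
    rw [List.length_cons] at h2
    by_cases h : i = d
    · exact ⟨a, by rw [h]; exact List.mem_cons_self⟩
    · obtain ⟨x, hx⟩ := ih (d + 1) i (by omega) (by omega)
      exact ⟨x, List.mem_cons_of_mem _ hx⟩

theorem cov_sound (w : List ℕ) : ∀ d y, (cov d w).testBit y = true →
    ∃ e ∈ arcsOf d w, y = e.1 ∨ y = e.1 + e.2 := by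
  induction w with
  | nil => intro d y h; simp [cov] at h
  | cons a t ih =>
    intro d y h
    have h' : (((2 ^ a ||| 2 ^ (a + d)) ||| cov (d + 1) t) : ℕ).testBit y = true := h
    rw [Nat.testBit_or, Nat.testBit_or, Nat.testBit_two_pow, Nat.testBit_two_pow] at h'
    simp only [Bool.or_eq_true, decide_eq_true_eq] at h'
    rcases h' with (h' | h') | h'
    · exact ⟨(a, d), List.mem_cons_self, Or.inl h'.symm⟩
    · exact ⟨(a, d), List.mem_cons_self, Or.inr h'.symm⟩
    · obtain ⟨e, he, h2⟩ := ih (d + 1) y h'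
      exact ⟨e, List.mem_cons_of_mem _ he, h2⟩

/-- Bit mask of the positions to be covered by the outer pairs. -/
def mask (m A g : ℕ) : ℕ :=
  Nat.lor (Nat.shiftLeft (2 ^ A - 1) 1) (Nat.shiftLeft (2 ^ (2 * m - A) - 1) (A + g + 1))

/-- Check of an explicit list of left ends. -/
def wcheck (n m A : ℕ) (w : List ℕ) : Bool :=
  Nat.beq w.length m && Nat.ble A (2 * m) && Nat.beq (cov (n + 4) w) (mask m A (2 * n + 1))

theorem wcheck_sound {n m A : ℕ} {w : List ℕ} (H : wcheck n m A w = true) :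
    A ≤ 2 * m ∧ Outer (n + 4) m A (2 * n + 1) := by
  simp only [wcheck, Bool.and_eq_true] at H
  obtain ⟨⟨h1, h2⟩, h3⟩ := H
  have h1 := Nat.eq_of_beq_eq_true h1
  have hA := Nat.le_of_ble_eq_true h2
  have h3 := Nat.eq_of_beq_eq_true h3
  refine ⟨hA, ?_⟩
  have hcI : (Finset.Icc (n + 4) (n + 4 + m - 1)).card = m := by
    rw [Nat.card_Icc]; omega
  apply part_of_cover _ _ (arcsOf (n + 4) w).toFinset
  · rw [hcI]
    exact (List.toFinset_card_le _).trans ((arcsOf_length w _).le.trans h1.le)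
  · rw [hcI, Finset.card_union_of_disjoint, Nat.card_Icc, Nat.card_Icc]
    · omega
    · rw [Finset.disjoint_left]
      intro x hx hy
      rw [Finset.mem_Icc] at hx hy
      omega
  · intro i hi
    rw [Finset.mem_Icc] at hi
    simp only [List.mem_toFinset]
    exact arcsOf_mem w _ i hi.1 (by omega)
  · intro y hy
    simp only [List.mem_toFinset]
    apply cov_sound
    rw [h3]
    change ((2 ^ A - 1) <<< 1 ||| (2 ^ (2 * m - A) - 1) <<< (A + (2 * n + 1) + 1)).testBit y = true
    rw [Nat.testBit_or, Nat.testBit_shiftLeft, Nat.testBit_shiftLeft, Nat.testBit_two_pow_sub_one,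
      Nat.testBit_two_pow_sub_one]
    simp only [Bool.or_eq_true, Bool.and_eq_true, decide_eq_true_eq]
    rw [Finset.mem_union, Finset.mem_Icc, Finset.mem_Icc] at hy
    omega

/-- The parity condition. -/
def parB (m k : ℕ) : Bool :=
  Nat.beq ((m / 2 + m + k) % 2) 1

/-- The pairs `(m, k)` covered by the theorem. -/
def Adm (m k : ℕ) : Prop :=
  (1 ≤ k ∧ k ≤ 2 * m + 1) ∧ (m / 2 + m + k) % 2 = 1 ∧
    (7 ≤ m ∨ (m = 6 ∧ 4 ≤ k ∧ k ≤ 10) ∨ (m = 5 ∧ k = 6))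

/-- `(m, k)` is obtained from a layer, possibly around an admissible smaller pair. -/
def Covered (m k : ℕ) : Prop :=
  ∃ n m' A, Outer (n + 4) m' A (2 * n + 1) ∧ m = n + m' ∧ 1 ≤ m' ∧ A ≤ 2 * m' ∧ A < k ∧
    k ≤ A + (2 * n + 1) ∧ (n = 0 ∨ 7 ≤ n ∧ (n / 2 + n + (k - A)) % 2 = 1)

theorem Covered.ext {m k : ℕ} (h : Covered m k)
    (ih : ∀ n < m, ∀ k, Adm n k → ExtLangford 4 n k) : ExtLangford 4 m k := by
  obtain ⟨n, m', A, ho, hm, hm', hA, hk, hk', hn⟩ := h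
  rcases hn with rfl | ⟨hn, hp⟩
  · have hmm : m = m' := by omega
    subst hmm
    exact of_outer_one (A := A) ho (by omega) hA
  · exact glue ho rfl rfl hm (by omega) hm' hA hk hk'
      (ih n (by omega) (k - A) ⟨⟨by omega, by omega⟩, hp, Or.inl hn⟩)

/-- The numerical parameters `(n, m', A)` of the parametric families. -/
def famNums : List (Form × Form × Form) := [
  ((7, 1), (21, 2), (0, 0)),
  ((8, 2), (24, 4), (0, 0)),
  ((8, 2), (27, 4), (0, 0)),
  ((8, 2), (28, 4), (0, 0)),
  ((8, 2), (31, 4), (0, 0)),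
  ((7, 1), (51, 6), (33, 4)),
  ((7, 1), (51, 6), (45, 6)),
  ((7, 1), (53, 6), (32, 4)),
  ((7, 1), (53, 6), (46, 6)),
  ((7, 1), (55, 6), (33, 4)),
  ((7, 1), (55, 6), (47, 6)),
  ((7, 1), (57, 6), (36, 4)),
  ((7, 1), (57, 6), (50, 6)),
  ((7, 1), (59, 6), (37, 4)),
  ((7, 1), (59, 6), (51, 6)),
  ((7, 1), (61, 6), (38, 4)),
  ((7, 1), (61, 6), (52, 6)),
  ((7, 1), (63, 6), (41, 4)),
  ((7, 1), (63, 6), (55, 6))]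

theorem famNums_outer : ∀ f ∈ famNums, ∀ s,
    Outer (ev f.1 s + 4) (ev f.2.1 s) (ev f.2.2 s) (2 * ev f.1 s + 1) := by
  have key : ∀ (n m' A : Form), (∀ s, Outer (n.1 + 4 + n.2 * s) (m'.1 + m'.2 * s) (A.1 + A.2 * s)
      (2 * n.1 + 1 + 2 * n.2 * s)) → ∀ s, Outer (ev n s + 4) (ev m' s) (ev A s) (2 * ev n s + 1) := by
    intro n m' A h s
    have e1 : ev n s + 4 = n.1 + 4 + n.2 * s := by simp only [ev]; ring
    have e2 : 2 * ev n s + 1 = 2 * n.1 + 1 + 2 * n.2 * s := by simp only [ev]; ring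
    rw [e1, e2]
    exact h s
  simp only [famNums, List.forall_mem_cons]
  refine ⟨
    key (7, 1) (21, 2) (0, 0) fam_3_0_7,
    key (8, 2) (24, 4) (0, 0) fam_6_0_8,
    key (8, 2) (27, 4) (0, 0) fam_6_0_11,
    key (8, 2) (28, 4) (0, 0) fam_6_0_12,
    key (8, 2) (31, 4) (0, 0) fam_6_0_15,
    key (7, 1) (51, 6) (33, 4) fam_7_4_9,
    key (7, 1) (51, 6) (45, 6) fam_7_6_9,
    key (7, 1) (53, 6) (32, 4) fam_7_4_11,
    key (7, 1) (53, 6) (46, 6) fam_7_6_11,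
    key (7, 1) (55, 6) (33, 4) fam_7_4_13,
    key (7, 1) (55, 6) (47, 6) fam_7_6_13,
    key (7, 1) (57, 6) (36, 4) fam_7_4_15,
    key (7, 1) (57, 6) (50, 6) fam_7_6_15,
    key (7, 1) (59, 6) (37, 4) fam_7_4_17,
    key (7, 1) (59, 6) (51, 6) fam_7_6_17,
    key (7, 1) (61, 6) (38, 4) fam_7_4_19,
    key (7, 1) (61, 6) (52, 6) fam_7_6_19,
    key (7, 1) (63, 6) (41, 4) fam_7_4_21,
    key (7, 1) (63, 6) (55, 6) fam_7_6_21,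
    ?_⟩
  intro f hf
  simp at hf

/-- A family covers `(m, k)`. -/
def famHit (m k : ℕ) (f : Form × Form × Form) : Bool :=
  (fun s => Nat.beq m (ev f.1 s + ev f.2.1 s) && Nat.ble (ev f.2.2 s) (2 * ev f.2.1 s) &&
    Nat.ble (ev f.2.2 s + 1) k && Nat.ble k (ev f.2.2 s + (2 * ev f.1 s + 1)) &&
    parB (ev f.1 s) (k - ev f.2.2 s) && Nat.ble 7 (ev f.1 s) && Nat.ble 1 (ev f.2.1 s))
    ((m - (f.1.1 + f.2.1.1)) / (f.1.2 + f.2.1.2))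

theorem famHit_sound {m k : ℕ} {f : Form × Form × Form} (hf : f ∈ famNums)
    (h : famHit m k f = true) : Covered m k := by
  have ho := famNums_outer f hf ((m - (f.1.1 + f.2.1.1)) / (f.1.2 + f.2.1.2))
  simp only [famHit] at h
  generalize ((m - (f.1.1 + f.2.1.1)) / (f.1.2 + f.2.1.2)) = s at ho h
  simp only [Bool.and_eq_true, parB] at h
  obtain ⟨⟨⟨⟨⟨⟨h1, h2⟩, h3⟩, h4⟩, h5⟩, h6⟩, h7⟩ := h
  exact ⟨_, _, _, ho, Nat.eq_of_beq_eq_true h1, Nat.le_of_ble_eq_true h7,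
    Nat.le_of_ble_eq_true h2, Nat.le_of_ble_eq_true h3, Nat.le_of_ble_eq_true h4,
    Or.inr ⟨Nat.le_of_ble_eq_true h6, Nat.eq_of_beq_eq_true h5⟩⟩

/-- An explicit layer: `(A, n, left ends)`. -/
abbrev Row := ℕ × ℕ × List ℕ

/-- The row is a valid layer for length `m`. -/
def rowOk (m : ℕ) (r : Row) : Bool :=
  Nat.ble (r.2.1 + 1) m && wcheck r.2.1 (m - r.2.1) r.1 r.2.2

/-- The row covers `k`. -/
def rowHit (k : ℕ) (r : Row) : Bool :=
  Nat.ble (r.1 + 1) k && Nat.ble k (r.1 + (2 * r.2.1 + 1)) &&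
    (Nat.beq r.2.1 0 || (Nat.ble 7 r.2.1 && parB r.2.1 (k - r.1)))

theorem row_sound {m k : ℕ} {r : Row} (h1 : rowOk m r = true) (h2 : rowHit k r = true) :
    Covered m k := by
  simp only [rowOk, Bool.and_eq_true] at h1
  obtain ⟨hA, ho⟩ := wcheck_sound h1.2
  have hn := Nat.le_of_ble_eq_true h1.1
  simp only [rowHit, Bool.and_eq_true, Bool.or_eq_true, parB] at h2
  obtain ⟨⟨h3, h4⟩, h5⟩ := h2
  refine ⟨_, _, _, ho, by omega, by omega, hA, Nat.le_of_ble_eq_true h3,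
    Nat.le_of_ble_eq_true h4, ?_⟩
  rcases h5 with h5 | h5
  · exact Or.inl (Nat.eq_of_beq_eq_true h5)
  · exact Or.inr ⟨Nat.le_of_ble_eq_true h5.1, Nat.eq_of_beq_eq_true h5.2⟩

/-- Test `k ≤ K`, `k` in the right parity class, downwards until `lo`. -/
def goodK (m lo : ℕ) (rows : List Row) : ℕ → Bool
  | 0 => true
  | k + 1 => goodK m lo rows k &&
      (!parB m (k + 1) || Nat.ble (k + 2) lo || rows.any (rowHit (k + 1)) ||
        famNums.any (famHit m (k + 1)))

theorem goodK_sound {m lo : ℕ} {rows : List Row} (hr : rows.all (rowOk m) = true) (K : ℕ) :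
    goodK m lo rows K = true → ∀ k, 1 ≤ k → lo ≤ k → k ≤ K → (m / 2 + m + k) % 2 = 1 →
      Covered m k := by
  induction K with
  | zero => intro _ k h1 _ h2; omega
  | succ K ih =>
    intro H k h1 hlo h2 hp
    rw [goodK, Bool.and_eq_true] at H
    by_cases hk : k ≤ K
    · exact ih H.1 k h1 hlo hk hp
    · have hk : k = K + 1 := by omega
      subst hk
      have h := H.2
      simp only [Bool.or_eq_true, List.any_eq_true] at h
      rcases h with ((h | h) | h) | h
      · have hp' : parB m (K + 1) = true := by
          simp only [parB]
          rw [hp]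
          rfl
        rw [hp'] at h
        simp at h
      · have := Nat.le_of_ble_eq_true h
        omega
      · obtain ⟨r, hrm, hr'⟩ := h
        exact row_sound (List.all_eq_true.1 hr r hrm) hr'
      · obtain ⟨f, hf, hf'⟩ := h
        exact famHit_sound hf hf'

/-- Check consecutive values of `m`. -/
def goodAll : ℕ → List (List Row) → Bool
  | _, [] => true
  | m, rows :: t => rows.all (rowOk m) &&
      goodK m (bif Nat.beq m 5 then 6 else bif Nat.beq m 6 then 4 else 1) rows (m + 1) &&
      goodAll (m + 1) t

theorem goodAll_sound (T : List (List Row)) : ∀ m0, goodAll m0 T = true →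
    ∀ m k, m0 ≤ m → m < m0 + T.length → k ≤ m + 1 → Adm m k → Covered m k := by
  induction T with
  | nil => intro m0 _ m k h1 h2; simp at h2; omega
  | cons rows t ih =>
    intro m0 H m k h1 h2 hk ha
    rw [goodAll, Bool.and_eq_true, Bool.and_eq_true] at H
    rw [List.length_cons] at h2
    by_cases hm : m = m0
    · subst hm
      refine goodK_sound H.1.1 _ H.1.2 k ha.1.1 ?_ hk ha.2.1
      obtain ⟨⟨h3, h4⟩, h5, h6⟩ := ha
      by_cases hm5 : m = 5
      · subst hm5
        change 6 ≤ k
        omega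
      · by_cases hm6 : m = 6
        · subst hm6
          change 4 ≤ k
          omega
        · have e5 : Nat.beq m 5 = false := by
            cases h : Nat.beq m 5 with
            | false => rfl
            | true => exact absurd (Nat.eq_of_beq_eq_true h) hm5
          have e6 : Nat.beq m 6 = false := by
            cases h : Nat.beq m 6 with
            | false => rfl
            | true => exact absurd (Nat.eq_of_beq_eq_true h) hm6
          rw [e5, e6]
          exact h3
    · exact ih (m0 + 1) H.2 m k (by omega) (by omega) hk ha

theorem covered_fam {m k : ℕ} (n m' A : Form) (hf : (n, m', A) ∈ famNums) (s : ℕ)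
    (hm : m = ev n s + ev m' s) (hm' : 1 ≤ ev m' s) (hA : ev A s ≤ 2 * ev m' s) (hk : ev A s < k)
    (hk' : k ≤ ev A s + (2 * ev n s + 1)) (hn : 7 ≤ ev n s)
    (hp : (ev n s / 2 + ev n s + (k - ev A s)) % 2 = 1) : Covered m k :=
  ⟨_, _, _, famNums_outer _ hf s, hm, hm', hA, hk, hk', Or.inr ⟨hn, hp⟩⟩

set_option maxHeartbeats 4000000 in
theorem low_cover {m k : ℕ} (hm : 69 ≤ m) (ha : Adm m k)
    (h : (m % 3 = 1 ∧ 3 * k ≤ 2 * (m - 7) + 3) ∨ (m % 6 = 2 ∧ 3 * k ≤ 2 * (m - 8) + 3) ∨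
      (m % 6 = 5 ∧ 3 * k ≤ 2 * (m - 11) + 3) ∨ (m % 6 = 0 ∧ 3 * k ≤ 2 * (m - 12) + 3) ∨
      (m % 6 = 3 ∧ 3 * k ≤ 2 * (m - 15) + 3)) : Covered m k := by
  obtain ⟨⟨h3, h4⟩, h5, h6⟩ := ha
  rcases h with ⟨h1, h2⟩ | ⟨h1, h2⟩ | ⟨h1, h2⟩ | ⟨h1, h2⟩ | ⟨h1, h2⟩
  · obtain ⟨s, rfl⟩ : ∃ s, m = 28 + 3 * s := ⟨(m - 28) / 3, by omega⟩
    obtain ⟨q, hq⟩ : ∃ q, s = 4 * q ∨ s = 4 * q + 1 ∨ s = 4 * q + 2 ∨ s = 4 * q + 3 :=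
      ⟨s / 4, by omega⟩
    refine covered_fam (7, 1) (21, 2) (0, 0) (by simp [famNums]) s ?_ ?_ ?_ ?_ ?_ ?_ ?_ <;>
      simp only [ev] <;> rcases hq with rfl | rfl | rfl | rfl <;> omega
  · obtain ⟨s, rfl⟩ : ∃ s, m = 32 + 6 * s := ⟨(m - 32) / 6, by omega⟩
    obtain ⟨q, hq⟩ : ∃ q, s = 4 * q ∨ s = 4 * q + 1 ∨ s = 4 * q + 2 ∨ s = 4 * q + 3 :=
      ⟨s / 4, by omega⟩
    refine covered_fam (8, 2) (24, 4) (0, 0) (by simp [famNums]) s ?_ ?_ ?_ ?_ ?_ ?_ ?_ <;>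
      simp only [ev] <;> rcases hq with rfl | rfl | rfl | rfl <;> omega
  · obtain ⟨s, rfl⟩ : ∃ s, m = 35 + 6 * s := ⟨(m - 35) / 6, by omega⟩
    obtain ⟨q, hq⟩ : ∃ q, s = 4 * q ∨ s = 4 * q + 1 ∨ s = 4 * q + 2 ∨ s = 4 * q + 3 :=
      ⟨s / 4, by omega⟩
    refine covered_fam (8, 2) (27, 4) (0, 0) (by simp [famNums]) s ?_ ?_ ?_ ?_ ?_ ?_ ?_ <;>
      simp only [ev] <;> rcases hq with rfl | rfl | rfl | rfl <;> omega
  · obtain ⟨s, rfl⟩ : ∃ s, m = 36 + 6 * s := ⟨(m - 36) / 6, by omega⟩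
    obtain ⟨q, hq⟩ : ∃ q, s = 4 * q ∨ s = 4 * q + 1 ∨ s = 4 * q + 2 ∨ s = 4 * q + 3 :=
      ⟨s / 4, by omega⟩
    refine covered_fam (8, 2) (28, 4) (0, 0) (by simp [famNums]) s ?_ ?_ ?_ ?_ ?_ ?_ ?_ <;>
      simp only [ev] <;> rcases hq with rfl | rfl | rfl | rfl <;> omega
  · obtain ⟨s, rfl⟩ : ∃ s, m = 39 + 6 * s := ⟨(m - 39) / 6, by omega⟩
    obtain ⟨q, hq⟩ : ∃ q, s = 4 * q ∨ s = 4 * q + 1 ∨ s = 4 * q + 2 ∨ s = 4 * q + 3 :=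
      ⟨s / 4, by omega⟩
    refine covered_fam (8, 2) (31, 4) (0, 0) (by simp [famNums]) s ?_ ?_ ?_ ?_ ?_ ?_ ?_ <;>
      simp only [ev] <;> rcases hq with rfl | rfl | rfl | rfl <;> omega

set_option maxHeartbeats 4000000 in
theorem big_cover {m k : ℕ} (hm : 69 ≤ m) (hk : k ≤ m + 1) (ha : Adm m k) : Covered m k := by
  have ha' := ha
  obtain ⟨⟨h3, h4⟩, h5, h6⟩ := ha'
  have h7 : m % 7 = 0 ∨ m % 7 = 1 ∨ m % 7 = 2 ∨ m % 7 = 3 ∨ m % 7 = 4 ∨ m % 7 = 5 ∨ m % 7 = 6 := by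
    omega
  rcases h7 with h7 | h7 | h7 | h7 | h7 | h7 | h7
  · obtain ⟨s, rfl⟩ : ∃ s, m = 70 + 7 * s := ⟨(m - 70) / 7, by omega⟩
    by_cases hA : k ≤ 41 + 4 * s
    · obtain ⟨q, hq⟩ : ∃ q, s = 6 * q ∨ s = 6 * q + 1 ∨ s = 6 * q + 2 ∨ s = 6 * q + 3 ∨
          s = 6 * q + 4 ∨ s = 6 * q + 5 := ⟨s / 6, by omega⟩
      refine low_cover hm ha ?_
      rcases Nat.eq_zero_or_pos q with rfl | hq0 <;>
        rcases hq with rfl | rfl | rfl | rfl | rfl | rfl <;> omega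
    · by_cases hB : k ≤ 55 + 6 * s
      · obtain ⟨q, hq⟩ : ∃ q, s = 4 * q ∨ s = 4 * q + 1 ∨ s = 4 * q + 2 ∨ s = 4 * q + 3 :=
          ⟨s / 4, by omega⟩
        refine covered_fam (7, 1) (63, 6) (41, 4) (by simp [famNums]) s ?_ ?_ ?_ ?_ ?_ ?_ ?_ <;>
          simp only [ev] <;> rcases hq with rfl | rfl | rfl | rfl <;> omega
      · obtain ⟨q, hq⟩ : ∃ q, s = 4 * q ∨ s = 4 * q + 1 ∨ s = 4 * q + 2 ∨ s = 4 * q + 3 :=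
          ⟨s / 4, by omega⟩
        refine covered_fam (7, 1) (63, 6) (55, 6) (by simp [famNums]) s ?_ ?_ ?_ ?_ ?_ ?_ ?_ <;>
          simp only [ev] <;> rcases hq with rfl | rfl | rfl | rfl <;> omega
  · obtain ⟨s, rfl⟩ : ∃ s, m = 64 + 7 * s := ⟨(m - 64) / 7, by omega⟩
    by_cases hA : k ≤ 36 + 4 * s
    · obtain ⟨q, hq⟩ : ∃ q, s = 6 * q ∨ s = 6 * q + 1 ∨ s = 6 * q + 2 ∨ s = 6 * q + 3 ∨
          s = 6 * q + 4 ∨ s = 6 * q + 5 := ⟨s / 6, by omega⟩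
      refine low_cover hm ha ?_
      rcases Nat.eq_zero_or_pos q with rfl | hq0 <;>
        rcases hq with rfl | rfl | rfl | rfl | rfl | rfl <;> omega
    · by_cases hB : k ≤ 50 + 6 * s
      · obtain ⟨q, hq⟩ : ∃ q, s = 4 * q ∨ s = 4 * q + 1 ∨ s = 4 * q + 2 ∨ s = 4 * q + 3 :=
          ⟨s / 4, by omega⟩
        refine covered_fam (7, 1) (57, 6) (36, 4) (by simp [famNums]) s ?_ ?_ ?_ ?_ ?_ ?_ ?_ <;>
          simp only [ev] <;> rcases hq with rfl | rfl | rfl | rfl <;> omega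
      · obtain ⟨q, hq⟩ : ∃ q, s = 4 * q ∨ s = 4 * q + 1 ∨ s = 4 * q + 2 ∨ s = 4 * q + 3 :=
          ⟨s / 4, by omega⟩
        refine covered_fam (7, 1) (57, 6) (50, 6) (by simp [famNums]) s ?_ ?_ ?_ ?_ ?_ ?_ ?_ <;>
          simp only [ev] <;> rcases hq with rfl | rfl | rfl | rfl <;> omega
  · obtain ⟨s, rfl⟩ : ∃ s, m = 58 + 7 * s := ⟨(m - 58) / 7, by omega⟩
    by_cases hA : k ≤ 33 + 4 * s
    · obtain ⟨q, hq⟩ : ∃ q, s = 6 * q ∨ s = 6 * q + 1 ∨ s = 6 * q + 2 ∨ s = 6 * q + 3 ∨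
          s = 6 * q + 4 ∨ s = 6 * q + 5 := ⟨s / 6, by omega⟩
      refine low_cover hm ha ?_
      rcases Nat.eq_zero_or_pos q with rfl | hq0 <;>
        rcases hq with rfl | rfl | rfl | rfl | rfl | rfl <;> omega
    · by_cases hB : k ≤ 45 + 6 * s
      · obtain ⟨q, hq⟩ : ∃ q, s = 4 * q ∨ s = 4 * q + 1 ∨ s = 4 * q + 2 ∨ s = 4 * q + 3 :=
          ⟨s / 4, by omega⟩
        refine covered_fam (7, 1) (51, 6) (33, 4) (by simp [famNums]) s ?_ ?_ ?_ ?_ ?_ ?_ ?_ <;>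
          simp only [ev] <;> rcases hq with rfl | rfl | rfl | rfl <;> omega
      · obtain ⟨q, hq⟩ : ∃ q, s = 4 * q ∨ s = 4 * q + 1 ∨ s = 4 * q + 2 ∨ s = 4 * q + 3 :=
          ⟨s / 4, by omega⟩
        refine covered_fam (7, 1) (51, 6) (45, 6) (by simp [famNums]) s ?_ ?_ ?_ ?_ ?_ ?_ ?_ <;>
          simp only [ev] <;> rcases hq with rfl | rfl | rfl | rfl <;> omega
  · obtain ⟨s, rfl⟩ : ∃ s, m = 66 + 7 * s := ⟨(m - 66) / 7, by omega⟩
    by_cases hA : k ≤ 37 + 4 * s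
    · obtain ⟨q, hq⟩ : ∃ q, s = 6 * q ∨ s = 6 * q + 1 ∨ s = 6 * q + 2 ∨ s = 6 * q + 3 ∨
          s = 6 * q + 4 ∨ s = 6 * q + 5 := ⟨s / 6, by omega⟩
      refine low_cover hm ha ?_
      rcases Nat.eq_zero_or_pos q with rfl | hq0 <;>
        rcases hq with rfl | rfl | rfl | rfl | rfl | rfl <;> omega
    · by_cases hB : k ≤ 51 + 6 * s
      · obtain ⟨q, hq⟩ : ∃ q, s = 4 * q ∨ s = 4 * q + 1 ∨ s = 4 * q + 2 ∨ s = 4 * q + 3 :=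
          ⟨s / 4, by omega⟩
        refine covered_fam (7, 1) (59, 6) (37, 4) (by simp [famNums]) s ?_ ?_ ?_ ?_ ?_ ?_ ?_ <;>
          simp only [ev] <;> rcases hq with rfl | rfl | rfl | rfl <;> omega
      · obtain ⟨q, hq⟩ : ∃ q, s = 4 * q ∨ s = 4 * q + 1 ∨ s = 4 * q + 2 ∨ s = 4 * q + 3 :=
          ⟨s / 4, by omega⟩
        refine covered_fam (7, 1) (59, 6) (51, 6) (by simp [famNums]) s ?_ ?_ ?_ ?_ ?_ ?_ ?_ <;>
          simp only [ev] <;> rcases hq with rfl | rfl | rfl | rfl <;> omega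
  · obtain ⟨s, rfl⟩ : ∃ s, m = 60 + 7 * s := ⟨(m - 60) / 7, by omega⟩
    by_cases hA : k ≤ 32 + 4 * s
    · obtain ⟨q, hq⟩ : ∃ q, s = 6 * q ∨ s = 6 * q + 1 ∨ s = 6 * q + 2 ∨ s = 6 * q + 3 ∨
          s = 6 * q + 4 ∨ s = 6 * q + 5 := ⟨s / 6, by omega⟩
      refine low_cover hm ha ?_
      rcases Nat.eq_zero_or_pos q with rfl | hq0 <;>
        rcases hq with rfl | rfl | rfl | rfl | rfl | rfl <;> omega
    · by_cases hB : k ≤ 46 + 6 * s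
      · obtain ⟨q, hq⟩ : ∃ q, s = 4 * q ∨ s = 4 * q + 1 ∨ s = 4 * q + 2 ∨ s = 4 * q + 3 :=
          ⟨s / 4, by omega⟩
        refine covered_fam (7, 1) (53, 6) (32, 4) (by simp [famNums]) s ?_ ?_ ?_ ?_ ?_ ?_ ?_ <;>
          simp only [ev] <;> rcases hq with rfl | rfl | rfl | rfl <;> omega
      · obtain ⟨q, hq⟩ : ∃ q, s = 4 * q ∨ s = 4 * q + 1 ∨ s = 4 * q + 2 ∨ s = 4 * q + 3 :=
          ⟨s / 4, by omega⟩
        refine covered_fam (7, 1) (53, 6) (46, 6) (by simp [famNums]) s ?_ ?_ ?_ ?_ ?_ ?_ ?_ <;>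
          simp only [ev] <;> rcases hq with rfl | rfl | rfl | rfl <;> omega
  · obtain ⟨s, rfl⟩ : ∃ s, m = 68 + 7 * s := ⟨(m - 68) / 7, by omega⟩
    by_cases hA : k ≤ 38 + 4 * s
    · obtain ⟨q, hq⟩ : ∃ q, s = 6 * q ∨ s = 6 * q + 1 ∨ s = 6 * q + 2 ∨ s = 6 * q + 3 ∨
          s = 6 * q + 4 ∨ s = 6 * q + 5 := ⟨s / 6, by omega⟩
      refine low_cover hm ha ?_
      rcases Nat.eq_zero_or_pos q with rfl | hq0 <;>
        rcases hq with rfl | rfl | rfl | rfl | rfl | rfl <;> omega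
    · by_cases hB : k ≤ 52 + 6 * s
      · obtain ⟨q, hq⟩ : ∃ q, s = 4 * q ∨ s = 4 * q + 1 ∨ s = 4 * q + 2 ∨ s = 4 * q + 3 :=
          ⟨s / 4, by omega⟩
        refine covered_fam (7, 1) (61, 6) (38, 4) (by simp [famNums]) s ?_ ?_ ?_ ?_ ?_ ?_ ?_ <;>
          simp only [ev] <;> rcases hq with rfl | rfl | rfl | rfl <;> omega
      · obtain ⟨q, hq⟩ : ∃ q, s = 4 * q ∨ s = 4 * q + 1 ∨ s = 4 * q + 2 ∨ s = 4 * q + 3 :=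
          ⟨s / 4, by omega⟩
        refine covered_fam (7, 1) (61, 6) (52, 6) (by simp [famNums]) s ?_ ?_ ?_ ?_ ?_ ?_ ?_ <;>
          simp only [ev] <;> rcases hq with rfl | rfl | rfl | rfl <;> omega
  · obtain ⟨s, rfl⟩ : ∃ s, m = 62 + 7 * s := ⟨(m - 62) / 7, by omega⟩
    by_cases hA : k ≤ 33 + 4 * s
    · obtain ⟨q, hq⟩ : ∃ q, s = 6 * q ∨ s = 6 * q + 1 ∨ s = 6 * q + 2 ∨ s = 6 * q + 3 ∨
          s = 6 * q + 4 ∨ s = 6 * q + 5 := ⟨s / 6, by omega⟩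
      refine low_cover hm ha ?_
      rcases Nat.eq_zero_or_pos q with rfl | hq0 <;>
        rcases hq with rfl | rfl | rfl | rfl | rfl | rfl <;> omega
    · by_cases hB : k ≤ 47 + 6 * s
      · obtain ⟨q, hq⟩ : ∃ q, s = 4 * q ∨ s = 4 * q + 1 ∨ s = 4 * q + 2 ∨ s = 4 * q + 3 :=
          ⟨s / 4, by omega⟩
        refine covered_fam (7, 1) (55, 6) (33, 4) (by simp [famNums]) s ?_ ?_ ?_ ?_ ?_ ?_ ?_ <;>
          simp only [ev] <;> rcases hq with rfl | rfl | rfl | rfl <;> omega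
      · obtain ⟨q, hq⟩ : ∃ q, s = 4 * q ∨ s = 4 * q + 1 ∨ s = 4 * q + 2 ∨ s = 4 * q + 3 :=
          ⟨s / 4, by omega⟩
        refine covered_fam (7, 1) (55, 6) (47, 6) (by simp [famNums]) s ?_ ?_ ?_ ?_ ?_ ?_ ?_ <;>
          simp only [ev] <;> rcases hq with rfl | rfl | rfl | rfl <;> omega

/-- Explicit layers for lengths `5` to `12`. -/
def tab5 : List (List Row) := [
  [(5, 0, [4, 2, 5, 3, 1])],
  [(5, 0, [8, 5, 1, 2, 3, 4]),
  (3, 0, [6, 7, 3, 1, 5, 2])],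
  [(6, 0, [2, 8, 9, 5, 3, 1, 4]),
  (4, 0, [3, 9, 6, 8, 2, 4, 1]),
  (2, 0, [4, 6, 9, 7, 5, 1, 2]),
  (0, 0, [7, 4, 8, 6, 2, 3, 5])],
  [(8, 0, [13, 2, 4, 8, 3, 5, 6, 1]),
  (6, 0, [2, 11, 4, 8, 9, 5, 3, 1]),
  (4, 0, [11, 4, 2, 10, 6, 7, 3, 1]),
  (2, 0, [5, 12, 4, 7, 8, 6, 1, 2]),
  (0, 0, [5, 11, 4, 6, 7, 8, 2, 3])],
  [(9, 0, [13, 2, 9, 1, 11, 3, 4, 5, 6]),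
  (7, 0, [14, 1, 9, 10, 4, 2, 3, 5, 7]),
  (5, 0, [14, 12, 3, 4, 2, 7, 5, 8, 1]),
  (3, 0, [11, 12, 1, 3, 5, 9, 6, 8, 2]),
  (1, 0, [15, 9, 4, 5, 3, 7, 8, 6, 1])],
  [(9, 0, [16, 14, 1, 8, 3, 4, 2, 6, 9, 5]),
  (7, 0, [15, 12, 4, 14, 1, 2, 3, 5, 6, 7]),
  (5, 0, [15, 13, 11, 1, 2, 3, 4, 5, 9, 7]),
  (3, 0, [13, 15, 10, 1, 3, 5, 2, 7, 9, 6]),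
  (1, 0, [16, 12, 7, 4, 1, 10, 5, 3, 6, 8])],
  [(10, 0, [13, 1, 15, 16, 2, 3, 4, 7, 8, 9, 5]),
  (8, 0, [13, 16, 1, 15, 2, 3, 4, 8, 11, 5, 6]),
  (6, 0, [15, 16, 4, 2, 14, 8, 3, 1, 11, 5, 6]),
  (4, 0, [2, 16, 8, 15, 9, 10, 3, 1, 11, 7, 4]),
  (2, 0, [14, 12, 16, 1, 2, 4, 5, 9, 11, 6, 7]),
  (0, 0, [19, 3, 12, 9, 6, 4, 10, 11, 5, 2, 7])],
  [(12, 0, [3, 14, 4, 17, 1, 16, 11, 12, 6, 2, 8, 5]),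
  (10, 0, [20, 1, 15, 2, 10, 7, 13, 3, 5, 12, 8, 4]),
  (8, 0, [1, 17, 13, 3, 4, 14, 15, 7, 8, 11, 2, 6]),
  (6, 0, [16, 17, 19, 4, 5, 1, 8, 3, 12, 2, 9, 6]),
  (4, 0, [7, 19, 12, 1, 14, 16, 10, 2, 3, 4, 9, 6]),
  (2, 0, [1, 15, 13, 16, 2, 8, 4, 7, 12, 9, 11, 6]),
  (0, 0, [16, 2, 13, 18, 4, 8, 5, 3, 10, 11, 9, 6])]]

theorem tab5_good : goodAll 5 tab5 = true := by
  decide +kernel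

/-- Explicit layers for lengths `13` to `20`. -/
def tab13 : List (List Row) := [
  [(13, 0, [22, 1, 7, 11, 19, 16, 2, 10, 3, 4, 9, 5, 8]),
  (11, 0, [3, 20, 15, 2, 14, 17, 1, 5, 6, 10, 13, 4, 8]),
  (9, 0, [19, 21, 1, 4, 12, 15, 6, 2, 5, 14, 8, 3, 9]),
  (7, 0, [1, 18, 14, 19, 7, 4, 2, 16, 9, 11, 3, 10, 6]),
  (5, 0, [1, 18, 20, 14, 3, 13, 7, 8, 4, 2, 10, 12, 9]),
  (3, 0, [2, 15, 19, 14, 16, 1, 3, 7, 5, 9, 12, 8, 11]),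
  (1, 0, [22, 7, 18, 1, 11, 14, 10, 4, 5, 3, 13, 6, 9])],
  [(13, 0, [22, 4, 18, 21, 2, 6, 13, 1, 7, 16, 3, 5, 11, 8]),
  (11, 0, [3, 18, 21, 1, 17, 2, 10, 13, 4, 15, 5, 14, 6, 9]),
  (9, 0, [18, 2, 23, 1, 13, 15, 17, 3, 4, 6, 11, 5, 12, 9]),
  (7, 0, [9, 2, 21, 18, 16, 1, 4, 12, 17, 15, 5, 11, 6, 3]),
  (5, 0, [17, 22, 2, 19, 5, 14, 1, 4, 16, 7, 10, 3, 9, 12]),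
  (3, 0, [1, 21, 3, 15, 12, 19, 8, 6, 11, 14, 2, 10, 13, 7]),
  (1, 0, [1, 24, 20, 15, 10, 12, 7, 3, 4, 6, 9, 13, 11, 8])],
  [(14, 0, [1, 3, 16, 6, 20, 2, 14, 18, 19, 17, 9, 12, 10, 4, 7]),
  (12, 0, [22, 4, 21, 3, 16, 20, 2, 6, 19, 5, 1, 8, 14, 11, 7]),
  (10, 0, [3, 1, 19, 22, 13, 18, 5, 20, 4, 10, 14, 2, 8, 9, 12]),
  (8, 0, [2, 3, 22, 19, 16, 1, 11, 12, 15, 17, 4, 5, 13, 14, 7]),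
  (6, 0, [1, 25, 16, 21, 18, 2, 10, 8, 3, 4, 9, 12, 13, 14, 6]),
  (4, 0, [23, 2, 22, 1, 18, 11, 15, 10, 4, 6, 3, 9, 13, 14, 12]),
  (2, 0, [21, 23, 5, 15, 4, 1, 17, 19, 6, 7, 2, 14, 8, 9, 13]),
  (0, 0, [24, 26, 16, 20, 3, 10, 4, 7, 5, 2, 9, 6, 13, 8, 12])],
  [(16, 0, [3, 1, 21, 18, 2, 24, 20, 15, 4, 9, 5, 8, 12, 14, 11, 13]),
  (14, 0, [23, 3, 1, 19, 2, 9, 22, 13, 4, 20, 17, 14, 5, 11, 12, 6]),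
  (12, 0, [2, 19, 9, 3, 25, 20, 21, 5, 18, 1, 12, 17, 7, 11, 4, 8]),
  (10, 0, [2, 27, 25, 5, 8, 15, 23, 17, 14, 9, 7, 3, 4, 13, 1, 10]),
  (8, 0, [2, 22, 23, 1, 20, 21, 5, 13, 7, 4, 11, 3, 10, 16, 14, 12]),
  (6, 0, [21, 22, 2, 5, 18, 19, 1, 3, 4, 20, 9, 17, 15, 13, 6, 10]),
  (4, 0, [6, 4, 2, 20, 16, 22, 13, 14, 21, 19, 15, 3, 1, 11, 12, 7]),
  (2, 0, [7, 1, 21, 23, 17, 19, 22, 4, 8, 5, 2, 9, 10, 12, 13, 14]),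
  (0, 0, [24, 10, 23, 7, 25, 4, 6, 20, 9, 19, 3, 11, 2, 5, 12, 8])],
  [(17, 0, [27, 1, 3, 14, 5, 25, 2, 15, 17, 19, 10, 20, 7, 16, 4, 11, 8]),
  (15, 0, [21, 24, 3, 26, 23, 4, 2, 6, 7, 22, 1, 5, 18, 10, 14, 11, 8]),
  (13, 0, [1, 3, 24, 20, 2, 26, 15, 6, 19, 9, 7, 13, 18, 16, 11, 4, 12]),
  (11, 0, [29, 4, 1, 23, 18, 25, 14, 16, 8, 2, 3, 6, 19, 5, 10, 13, 11]),
  (9, 0, [28, 4, 1, 18, 6, 15, 21, 5, 22, 20, 13, 2, 19, 12, 8, 11, 3]),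
  (7, 0, [23, 2, 15, 22, 6, 24, 25, 5, 1, 18, 3, 19, 4, 9, 10, 11, 12]),
  (5, 0, [27, 25, 1, 3, 15, 9, 19, 2, 22, 11, 12, 5, 16, 4, 17, 14, 8]),
  (3, 0, [30, 21, 2, 25, 1, 11, 19, 17, 6, 3, 10, 12, 7, 5, 13, 14, 15]),
  (1, 0, [27, 8, 16, 3, 25, 26, 7, 23, 9, 6, 15, 5, 12, 1, 14, 11, 4])],
  [(17, 0, [9, 22, 30, 1, 2, 28, 24, 4, 17, 19, 12, 5, 7, 16, 3, 6, 11, 14]),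
  (15, 0, [29, 31, 3, 25, 6, 17, 2, 24, 11, 15, 4, 7, 5, 20, 1, 8, 10, 13]),
  (13, 0, [2, 26, 23, 3, 5, 18, 1, 25, 8, 22, 16, 9, 17, 4, 19, 15, 12, 7]),
  (11, 0, [19, 5, 21, 1, 28, 2, 3, 26, 22, 7, 18, 15, 17, 14, 6, 16, 9, 4]),
  (9, 0, [4, 2, 23, 25, 3, 22, 24, 9, 18, 1, 12, 13, 5, 19, 15, 16, 17, 6]),
  (7, 0, [21, 29, 26, 30, 9, 22, 3, 1, 2, 6, 10, 5, 11, 18, 15, 4, 16, 7]),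
  (5, 0, [24, 27, 4, 30, 5, 26, 12, 9, 3, 18, 11, 2, 7, 19, 16, 14, 1, 8]),
  (3, 0, [3, 27, 17, 29, 22, 5, 18, 1, 21, 2, 6, 10, 8, 9, 19, 16, 11, 13]),
  (1, 0, [27, 8, 16, 29, 25, 1, 9, 3, 23, 17, 4, 11, 5, 20, 6, 15, 12, 7])],
  [(18, 0, [31, 2, 30, 15, 1, 16, 29, 3, 20, 5, 24, 6, 12, 10, 8, 4, 17, 13, 11]),
  (16, 0, [4, 5, 23, 2, 27, 25, 21, 3, 24, 19, 6, 1, 22, 11, 12, 7, 13, 18, 15]),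
  (14, 0, [26, 33, 4, 28, 5, 23, 29, 3, 6, 12, 8, 19, 11, 7, 2, 17, 1, 16, 9]),
  (12, 0, [27, 4, 17, 1, 3, 29, 2, 19, 16, 7, 22, 24, 21, 18, 15, 6, 14, 5, 10]),
  (10, 0, [1, 4, 23, 7, 24, 17, 2, 27, 22, 20, 25, 6, 3, 13, 18, 16, 8, 10, 15]),
  (8, 0, [3, 1, 15, 26, 30, 28, 2, 16, 17, 22, 11, 5, 8, 19, 13, 4, 14, 18, 10]),
  (6, 0, [10, 32, 33, 27, 21, 3, 16, 2, 24, 5, 11, 15, 4, 6, 17, 19, 8, 1, 9]),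
  (4, 0, [31, 3, 7, 23, 2, 17, 24, 4, 25, 6, 14, 21, 16, 12, 9, 20, 18, 1, 11]),
  (2, 0, [5, 28, 2, 4, 7, 22, 25, 21, 24, 13, 20, 12, 14, 6, 1, 10, 17, 18, 16]),
  (0, 0, [32, 3, 23, 2, 22, 5, 10, 28, 6, 13, 21, 19, 11, 7, 15, 12, 17, 4, 16])],
  [(20, 0, [36, 6, 33, 31, 5, 8, 18, 26, 10, 2, 20, 12, 3, 24, 14, 16, 9, 4, 1, 7]),
  (18, 0, [1, 29, 31, 2, 7, 3, 23, 25, 6, 17, 13, 11, 24, 4, 20, 22, 8, 14, 10, 16]),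
  (16, 0, [5, 1, 28, 8, 13, 30, 2, 29, 20, 22, 27, 11, 7, 16, 18, 19, 4, 10, 3, 14]),
  (14, 0, [2, 5, 28, 32, 8, 20, 1, 7, 19, 24, 27, 21, 14, 9, 22, 4, 13, 17, 3, 12]),
  (12, 0, [32, 22, 31, 28, 4, 1, 6, 30, 2, 21, 15, 9, 7, 3, 8, 19, 5, 18, 11, 17]),
  (10, 0, [33, 4, 24, 1, 26, 5, 2, 10, 28, 19, 15, 16, 6, 18, 23, 20, 7, 17, 3, 13]),
  (8, 0, [8, 1, 5, 33, 27, 28, 13, 21, 24, 4, 20, 14, 15, 2, 7, 22, 10, 18, 16, 3]),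
  (6, 0, [22, 27, 2, 34, 9, 4, 1, 28, 19, 5, 24, 14, 20, 6, 12, 21, 15, 16, 3, 10]),
  (4, 0, [21, 35, 27, 3, 31, 6, 28, 2, 17, 7, 9, 19, 8, 1, 12, 22, 16, 11, 4, 14]),
  (2, 0, [27, 9, 2, 4, 25, 1, 7, 23, 29, 22, 18, 21, 12, 13, 20, 5, 6, 19, 15, 16]),
  (0, 0, [35, 7, 23, 4, 5, 6, 26, 30, 16, 18, 19, 9, 21, 3, 22, 8, 14, 17, 10, 2])]]

theorem tab13_good : goodAll 13 tab13 = true := by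
  decide +kernel

/-- Explicit layers for lengths `21` to `28`. -/
def tab21 : List (List Row) := [
  [(21, 0, [1, 4, 26, 29, 2, 7, 30, 23, 25, 6, 3, 27, 8, 11, 15, 12, 21, 18, 13, 20, 14]),
  (19, 0, [31, 33, 34, 1, 4, 5, 7, 30, 6, 15, 9, 22, 13, 10, 21, 24, 16, 11, 3, 19, 2]),
  (17, 0, [36, 2, 23, 34, 3, 4, 5, 17, 27, 24, 19, 6, 16, 25, 8, 1, 10, 22, 9, 12, 14]),
  (15, 0, [4, 2, 31, 33, 9, 3, 18, 30, 22, 11, 21, 5, 26, 15, 25, 10, 19, 6, 1, 13, 14]),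
  (13, 0, [1, 38, 4, 2, 29, 7, 17, 25, 12, 19, 28, 8, 18, 22, 13, 21, 15, 20, 11, 3, 6]),
  (11, 0, [3, 15, 37, 29, 27, 4, 23, 30, 2, 26, 8, 16, 1, 21, 6, 9, 5, 11, 18, 19, 10]),
  (9, 0, [34, 2, 26, 30, 3, 5, 33, 8, 17, 18, 25, 12, 6, 4, 24, 9, 15, 20, 1, 13, 16]),
  (7, 0, [5, 6, 29, 24, 25, 34, 18, 12, 30, 1, 26, 2, 3, 4, 20, 22, 7, 16, 10, 13, 15]),
  (5, 0, [24, 36, 31, 4, 8, 13, 2, 3, 30, 27, 15, 23, 17, 18, 7, 1, 19, 5, 21, 9, 10]),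
  (3, 0, [3, 22, 5, 21, 34, 1, 2, 9, 29, 18, 23, 24, 19, 13, 25, 14, 6, 15, 16, 17, 8]),
  (1, 0, [1, 17, 26, 6, 3, 30, 31, 27, 12, 8, 28, 4, 18, 23, 7, 10, 16, 14, 15, 20, 9])],
  [(21, 0, [1, 9, 32, 8, 36, 3, 27, 30, 28, 7, 4, 19, 13, 16, 21, 24, 6, 10, 23, 2, 11, 17]),
  (19, 0, [1, 6, 4, 2, 21, 33, 27, 30, 12, 3, 18, 23, 28, 22, 17, 7, 25, 13, 14, 8, 19, 15]),
  (17, 0, [5, 26, 6, 1, 28, 11, 29, 33, 2, 3, 23, 27, 25, 17, 4, 21, 15, 24, 10, 7, 19, 13]),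
  (15, 0, [38, 23, 37, 5, 26, 9, 1, 29, 2, 32, 7, 15, 4, 22, 17, 6, 24, 10, 19, 13, 3, 8]),
  (13, 0, [4, 30, 5, 9, 2, 29, 3, 28, 21, 6, 18, 26, 24, 17, 27, 25, 22, 15, 1, 20, 7, 12]),
  (11, 0, [32, 37, 38, 21, 31, 7, 24, 3, 1, 4, 19, 5, 6, 10, 25, 26, 9, 2, 8, 18, 11, 15]),
  (9, 0, [41, 31, 29, 1, 3, 30, 2, 17, 26, 9, 20, 4, 7, 25, 14, 5, 13, 6, 15, 21, 16, 18]),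
  (7, 0, [32, 10, 3, 33, 30, 2, 24, 16, 31, 12, 4, 7, 29, 6, 26, 20, 1, 14, 19, 5, 13, 17]),
  (5, 0, [35, 18, 3, 27, 36, 2, 32, 10, 14, 7, 1, 30, 24, 8, 13, 22, 17, 12, 16, 5, 19, 4]),
  (3, 0, [36, 9, 17, 3, 29, 7, 33, 1, 30, 13, 21, 19, 2, 24, 20, 8, 25, 11, 22, 5, 15, 6]),
  (1, 0, [29, 6, 4, 7, 5, 12, 27, 31, 26, 30, 3, 25, 20, 18, 16, 22, 8, 24, 1, 9, 15, 19])],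
  [(22, 0, [32, 2, 37, 1, 38, 3, 6, 17, 15, 5, 31, 20, 9, 24, 11, 21, 13, 26, 22, 19, 10, 14, 4]),
  (20, 0, [3, 27, 36, 1, 4, 11, 5, 28, 13, 34, 19, 31, 29, 6, 26, 22, 18, 9, 2, 14, 16, 10, 17]),
  (18, 0, [36, 30, 2, 31, 34, 1, 3, 5, 6, 4, 15, 11, 12, 20, 27, 22, 24, 25, 21, 9, 23, 14, 7]),
  (16, 0, [37, 6, 3, 31, 4, 25, 5, 2, 30, 10, 21, 28, 29, 16, 8, 20, 27, 19, 14, 1, 22, 7, 18]),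
  (14, 0, [3, 6, 4, 27, 5, 36, 31, 28, 2, 17, 26, 18, 9, 21, 29, 24, 22, 16, 1, 12, 8, 19, 20]),
  (12, 0, [40, 26, 39, 4, 27, 38, 20, 1, 6, 2, 3, 22, 16, 7, 23, 9, 14, 25, 21, 19, 5, 8, 10]),
  (10, 0, [1, 25, 2, 3, 4, 27, 9, 7, 34, 29, 26, 20, 15, 16, 21, 28, 24, 22, 23, 14, 17, 13, 6]),
  (8, 0, [26, 2, 31, 5, 8, 38, 1, 35, 21, 32, 13, 10, 18, 3, 24, 22, 19, 23, 14, 6, 4, 15, 17]),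
  (6, 0, [42, 28, 37, 4, 23, 5, 3, 27, 6, 9, 26, 32, 25, 17, 12, 1, 16, 8, 2, 21, 15, 10, 19]),
  (4, 0, [2, 30, 8, 3, 36, 23, 11, 34, 4, 7, 24, 22, 27, 29, 13, 9, 19, 12, 25, 17, 18, 1, 15]),
  (2, 0, [20, 5, 40, 1, 6, 13, 32, 33, 29, 25, 23, 30, 2, 9, 16, 12, 15, 7, 17, 4, 19, 11, 21]),
  (0, 0, [8, 31, 27, 2, 3, 34, 5, 18, 35, 32, 23, 6, 14, 25, 10, 7, 4, 20, 16, 17, 22, 19, 13])],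
  [(24, 0, [34, 37, 1, 8, 10, 2, 3, 28, 32, 30, 5, 9, 29, 16, 31, 17, 20, 6, 4, 12, 22, 23, 21,
    14]),
  (22, 0, [3, 5, 33, 34, 11, 35, 4, 2, 28, 12, 1, 22, 20, 31, 29, 8, 18, 9, 24, 26, 21, 17, 6,
    16]),
  (20, 0, [4, 1, 32, 37, 5, 24, 36, 12, 27, 7, 2, 3, 26, 30, 25, 10, 28, 14, 9, 11, 17, 15, 19,
    22]),
  (18, 0, [4, 24, 38, 3, 5, 40, 36, 9, 15, 26, 18, 1, 31, 28, 25, 2, 22, 14, 12, 7, 17, 23, 11,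
    6]),
  (16, 0, [1, 6, 8, 2, 7, 24, 3, 25, 34, 22, 30, 27, 31, 26, 19, 21, 29, 20, 10, 16, 4, 23, 12,
    18]),
  (14, 0, [1, 2, 6, 3, 8, 25, 22, 17, 36, 26, 9, 31, 33, 27, 29, 24, 18, 21, 19, 14, 11, 20, 4,
    13]),
  (12, 0, [8, 2, 3, 11, 31, 1, 4, 30, 36, 21, 19, 25, 22, 27, 28, 26, 15, 16, 20, 6, 23, 24, 17,
    5]),
  (10, 0, [5, 1, 33, 21, 35, 36, 4, 38, 8, 12, 13, 17, 30, 31, 24, 10, 2, 19, 15, 3, 23, 16, 18,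
    7]),
  (8, 0, [26, 37, 11, 1, 2, 14, 34, 36, 4, 27, 35, 31, 13, 24, 3, 20, 5, 12, 6, 15, 19, 7, 22,
    18]),
  (6, 0, [39, 5, 2, 12, 3, 4, 18, 25, 30, 32, 21, 29, 33, 6, 20, 15, 26, 16, 9, 17, 24, 22, 1,
    14]),
  (4, 0, [4, 29, 3, 36, 13, 37, 14, 38, 33, 31, 28, 7, 10, 2, 12, 6, 15, 11, 18, 16, 17, 23, 1,
    20]),
  (2, 0, [38, 10, 1, 2, 25, 5, 24, 6, 27, 23, 32, 4, 31, 11, 26, 30, 21, 8, 13, 20, 16, 12, 22,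
    18]),
  (0, 0, [2, 43, 34, 38, 4, 8, 9, 33, 24, 7, 27, 10, 26, 13, 14, 16, 11, 18, 15, 23, 5, 3, 21,
    22])],
  [(25, 0, [3, 41, 4, 44, 6, 2, 22, 31, 9, 27, 20, 30, 23, 1, 15, 5, 28, 29, 16, 13, 25, 12, 17, 8,
    19]),
  (23, 0, [41, 5, 12, 30, 1, 2, 16, 4, 21, 35, 3, 36, 27, 32, 22, 25, 19, 29, 6, 23, 7, 13, 8, 20,
    14]),
  (21, 0, [33, 5, 9, 4, 40, 3, 13, 21, 38, 28, 31, 27, 35, 1, 16, 6, 29, 26, 2, 7, 19, 14, 20, 17,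
    8]),
  (19, 0, [10, 1, 45, 4, 8, 32, 9, 28, 24, 31, 34, 35, 2, 25, 15, 27, 23, 17, 7, 3, 13, 5, 21, 22,
    12]),
  (17, 0, [31, 38, 4, 2, 41, 11, 6, 29, 7, 24, 3, 36, 32, 5, 12, 25, 13, 26, 23, 27, 15, 21, 8, 1,
    14]),
  (15, 0, [4, 5, 42, 14, 35, 2, 20, 38, 39, 12, 3, 31, 13, 23, 18, 22, 24, 26, 15, 27, 9, 7, 19,
    1, 6]),
  (13, 0, [4, 1, 7, 9, 3, 19, 27, 31, 32, 17, 36, 5, 33, 34, 21, 24, 18, 26, 23, 25, 22, 10, 15,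
    2, 12]),
  (11, 0, [42, 40, 8, 6, 2, 41, 27, 9, 3, 18, 22, 34, 19, 16, 30, 25, 23, 17, 7, 1, 4, 26, 21, 5,
    11]),
  (9, 0, [28, 35, 6, 4, 42, 25, 39, 37, 3, 1, 8, 2, 20, 16, 26, 19, 23, 9, 7, 24, 27, 21, 5, 18,
    13]),
  (7, 0, [15, 36, 3, 5, 32, 4, 1, 39, 31, 25, 7, 22, 29, 10, 17, 30, 14, 26, 2, 28, 20, 23, 16, 6,
    18]),
  (5, 0, [43, 45, 30, 2, 20, 7, 1, 37, 32, 14, 5, 34, 10, 8, 24, 22, 13, 17, 18, 12, 15, 21, 3, 4,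
    23]),
  (3, 0, [29, 45, 42, 44, 27, 5, 6, 25, 31, 13, 10, 34, 1, 3, 22, 2, 18, 7, 8, 9, 23, 12, 15, 19,
    11]),
  (1, 0, [41, 4, 42, 1, 7, 5, 34, 18, 23, 12, 22, 31, 33, 20, 21, 13, 10, 3, 6, 27, 16, 26, 17,
    11, 19])],
  [(25, 0, [4, 43, 3, 12, 36, 7, 10, 38, 30, 34, 1, 35, 11, 22, 28, 14, 21, 2, 18, 29, 13, 6, 25,
    5, 17, 24]),
  (23, 0, [33, 40, 2, 5, 10, 7, 1, 35, 31, 38, 9, 29, 20, 30, 3, 6, 14, 32, 28, 4, 15, 17, 26, 22,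
    13, 19]),
  (21, 0, [2, 3, 14, 40, 5, 1, 42, 18, 4, 19, 25, 28, 30, 27, 33, 34, 17, 24, 9, 12, 26, 23, 15,
    11, 21, 7]),
  (19, 0, [46, 42, 11, 9, 45, 19, 39, 40, 3, 31, 23, 14, 32, 21, 6, 7, 2, 12, 30, 4, 1, 18, 10, 8,
    13, 5]),
  (17, 0, [30, 47, 33, 38, 7, 8, 4, 37, 41, 29, 32, 5, 3, 9, 13, 25, 2, 6, 1, 28, 12, 10, 24, 16,
    21, 11]),
  (15, 0, [35, 40, 11, 7, 4, 43, 38, 33, 34, 13, 18, 8, 25, 3, 1, 2, 27, 29, 31, 5, 6, 24, 10, 15,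
    9, 22]),
  (13, 0, [5, 8, 35, 37, 3, 6, 2, 31, 27, 36, 19, 1, 4, 30, 28, 29, 18, 22, 23, 17, 10, 7, 26, 24,
    25, 21]),
  (11, 0, [3, 15, 35, 1, 5, 38, 9, 31, 10, 33, 37, 17, 36, 26, 16, 29, 25, 6, 2, 30, 4, 14, 18,
    23, 21, 11]),
  (9, 0, [46, 4, 6, 17, 43, 44, 39, 15, 21, 34, 22, 1, 32, 14, 7, 23, 18, 19, 5, 29, 11, 20, 2, 3,
    13, 8]),
  (7, 0, [40, 4, 15, 36, 5, 38, 10, 23, 41, 1, 2, 30, 11, 25, 33, 18, 12, 7, 17, 29, 26, 24, 22,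
    19, 3, 6]),
  (5, 0, [10, 39, 7, 42, 4, 34, 1, 26, 33, 2, 17, 20, 5, 19, 30, 28, 3, 25, 18, 29, 8, 16, 27, 24,
    22, 9]),
  (3, 0, [38, 41, 9, 10, 32, 44, 35, 36, 6, 39, 2, 14, 11, 20, 13, 3, 23, 12, 8, 5, 1, 26, 24, 7,
    21, 19]),
  (1, 0, [7, 4, 39, 34, 6, 8, 16, 37, 13, 33, 38, 12, 5, 32, 22, 24, 15, 30, 31, 19, 20, 3, 10,
    23, 1, 18])],
  [(26, 0, [11, 42, 29, 3, 31, 45, 4, 6, 8, 37, 34, 9, 7, 1, 33, 36, 26, 22, 30, 21, 16, 13, 2, 5,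
    25, 12, 19]),
  (24, 0, [1, 2, 4, 43, 31, 45, 24, 44, 15, 8, 3, 38, 12, 23, 29, 18, 32, 9, 19, 13, 11, 26, 22,
    6, 14, 20, 16]),
  (22, 0, [2, 44, 8, 5, 28, 4, 1, 35, 21, 39, 26, 38, 3, 10, 32, 18, 31, 22, 25, 7, 17, 9, 29, 15,
    20, 16, 24]),
  (20, 0, [44, 3, 16, 30, 46, 5, 2, 27, 35, 6, 1, 34, 9, 24, 32, 4, 33, 10, 20, 17, 28, 26, 29,
    18, 11, 7, 13]),
  (18, 0, [47, 7, 2, 3, 37, 9, 34, 31, 16, 30, 1, 5, 38, 33, 21, 29, 4, 11, 13, 23, 17, 27, 14,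
    22, 25, 26, 6]),
  (16, 0, [5, 8, 1, 4, 39, 36, 40, 35, 20, 42, 15, 16, 28, 2, 30, 22, 6, 33, 12, 14, 3, 18, 23,
    25, 10, 24, 21]),
  (14, 0, [4, 41, 38, 3, 32, 2, 45, 1, 6, 29, 14, 20, 17, 37, 13, 34, 7, 22, 26, 16, 23, 5, 25, 9,
    24, 21, 19]),
  (12, 0, [4, 47, 3, 39, 23, 21, 45, 1, 29, 37, 10, 18, 38, 15, 35, 7, 2, 27, 6, 20, 16, 11, 25,
    17, 14, 5, 19]),
  (10, 0, [6, 8, 48, 38, 7, 43, 4, 1, 27, 40, 20, 22, 25, 19, 17, 30, 24, 5, 28, 9, 31, 21, 16, 2,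
    23, 18, 3]),
  (8, 0, [4, 19, 7, 35, 33, 14, 1, 36, 31, 32, 3, 5, 2, 38, 21, 6, 34, 29, 30, 26, 27, 28, 22, 10,
    12, 15, 16]),
  (6, 0, [1, 44, 47, 9, 40, 14, 3, 20, 38, 19, 8, 18, 35, 37, 28, 17, 21, 24, 4, 11, 6, 2, 29, 25,
    15, 10, 12]),
  (4, 0, [50, 15, 43, 38, 44, 8, 41, 10, 36, 22, 28, 14, 2, 6, 16, 13, 4, 25, 31, 3, 9, 30, 1, 12,
    19, 11, 7]),
  (2, 0, [48, 5, 45, 33, 6, 16, 43, 27, 30, 11, 41, 17, 4, 1, 13, 35, 26, 8, 12, 21, 15, 22, 2,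
    23, 9, 7, 19]),
  (0, 0, [39, 8, 40, 7, 36, 2, 31, 4, 9, 6, 18, 10, 34, 38, 33, 16, 17, 27, 23, 5, 30, 22, 3, 26,
    24, 20, 12])],
  [(28, 0, [18, 14, 40, 44, 42, 39, 11, 41, 33, 3, 1, 2, 4, 6, 10, 5, 27, 34, 32, 26, 13, 31, 9,
    30, 25, 7, 8, 12]),
  (26, 0, [3, 49, 2, 25, 44, 38, 4, 45, 9, 42, 36, 13, 35, 12, 16, 18, 20, 1, 17, 10, 6, 23, 5,
    19, 15, 24, 11, 26]),
  (24, 0, [42, 16, 43, 41, 4, 14, 44, 9, 39, 2, 3, 37, 34, 1, 13, 26, 10, 19, 33, 5, 11, 22, 6,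
    29, 8, 24, 27, 7]),
  (22, 0, [50, 47, 2, 3, 5, 44, 35, 14, 18, 33, 7, 26, 1, 34, 4, 19, 16, 28, 20, 9, 24, 31, 29,
    12, 15, 11, 27, 6]),
  (6, 7, [39, 33, 40, 42, 37, 41, 38, 25, 35, 28, 23, 24, 26, 27, 22, 3, 4, 2, 5, 6, 1])]]

theorem tab21_good : goodAll 21 tab21 = true := by
  decide +kernel

/-- Explicit layers for lengths `29` to `36`. -/
def tab29 : List (List Row) := [
  [(29, 0, [6, 14, 7, 51, 44, 45, 15, 46, 47, 37, 28, 1, 5, 23, 20, 17, 4, 32, 27, 18, 11, 8, 22,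
    29, 3, 26, 9, 12, 2]),
  (27, 0, [54, 2, 3, 4, 47, 24, 22, 1, 14, 38, 6, 10, 40, 31, 39, 34, 29, 16, 19, 21, 18, 27, 17,
    23, 8, 30, 5, 15, 13]),
  (25, 0, [13, 52, 29, 2, 39, 49, 4, 34, 3, 12, 40, 5, 7, 38, 28, 37, 21, 10, 8, 36, 27, 19, 16,
    6, 22, 24, 18, 1, 11]),
  (23, 0, [40, 9, 1, 51, 8, 3, 5, 25, 41, 10, 42, 28, 21, 29, 17, 38, 39, 11, 33, 31, 6, 2, 26,
    22, 20, 18, 4, 19, 13]),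
  (7, 7, [43, 41, 42, 44, 32, 40, 35, 39, 27, 28, 30, 23, 26, 1, 34, 24, 2, 3, 4, 6, 7, 5]),
  (1, 7, [23, 25, 36, 32, 39, 40, 38, 35, 31, 21, 27, 20, 24, 28, 18, 19, 17, 30, 22, 29, 26, 1])],
  [(29, 0, [6, 43, 2, 16, 41, 26, 7, 1, 9, 44, 5, 45, 40, 37, 14, 31, 4, 13, 33, 38, 15, 28, 25,
    20, 18, 29, 22, 11, 27, 3]),
  (27, 0, [6, 21, 54, 48, 1, 11, 37, 5, 38, 40, 29, 44, 3, 35, 12, 4, 22, 13, 36, 2, 15, 31, 7,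
    24, 18, 32, 27, 14, 17, 8]),
  (25, 0, [2, 5, 50, 11, 41, 43, 48, 16, 39, 42, 23, 14, 4, 36, 12, 15, 1, 38, 3, 8, 22, 19, 28,
    33, 7, 32, 17, 9, 13, 24]),
  (23, 0, [4, 27, 51, 6, 44, 50, 43, 9, 46, 10, 35, 7, 1, 28, 3, 36, 34, 12, 26, 16, 18, 15, 11,
    14, 19, 2, 30, 25, 29, 5]),
  (7, 7, [42, 44, 37, 40, 46, 32, 43, 41, 26, 27, 30, 1, 35, 31, 24, 2, 25, 29, 5, 3, 7, 4, 6]),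
  (1, 7, [33, 41, 39, 32, 22, 35, 31, 38, 36, 34, 19, 21, 1, 18, 25, 23, 20, 17, 29, 30, 26, 27,
    28])],
  [(30, 0, [29, 4, 5, 1, 2, 51, 16, 17, 3, 24, 6, 42, 45, 32, 44, 27, 34, 38, 19, 35, 39, 30, 21,
    25, 12, 7, 13, 22, 18, 23, 14]),
  (28, 0, [7, 8, 45, 46, 48, 22, 49, 4, 50, 34, 19, 40, 16, 1, 39, 6, 3, 9, 2, 21, 17, 35, 26, 36,
    10, 14, 12, 27, 5, 28, 20]),
  (26, 0, [5, 58, 49, 11, 33, 31, 2, 51, 35, 3, 46, 15, 1, 44, 6, 37, 32, 22, 20, 13, 4, 29, 19,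
    7, 10, 21, 23, 8, 25, 26, 14]),
  (24, 0, [3, 6, 46, 49, 12, 8, 4, 21, 36, 22, 47, 43, 37, 10, 1, 31, 39, 34, 40, 28, 2, 16, 18,
    15, 5, 9, 30, 23, 13, 24, 29]),
  (8, 7, [44, 46, 36, 43, 45, 47, 39, 30, 34, 42, 31, 3, 28, 26, 2, 35, 32, 1, 4, 24, 6, 8, 5, 7])],
  [(32, 0, [5, 14, 6, 54, 16, 53, 3, 30, 44, 15, 32, 43, 1, 47, 39, 36, 7, 8, 38, 40, 18, 23, 11,
    25, 21, 22, 20, 4, 2, 26, 31, 10]),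
  (30, 0, [1, 11, 3, 45, 7, 40, 38, 17, 51, 24, 6, 4, 2, 36, 8, 41, 44, 29, 10, 35, 30, 21, 39,
    34, 14, 33, 13, 25, 27, 22, 23, 12]),
  (28, 0, [5, 14, 39, 41, 50, 1, 18, 43, 40, 44, 49, 46, 8, 3, 17, 2, 42, 11, 12, 4, 13, 6, 7, 38,
    36, 30, 23, 25, 15, 22, 26, 16]),
  (26, 0, [5, 6, 4, 31, 39, 7, 46, 3, 1, 2, 50, 25, 32, 43, 8, 44, 33, 34, 20, 35, 17, 12, 36, 18,
    24, 22, 19, 28, 29, 21, 23, 30]),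
  (10, 7, [45, 43, 48, 50, 47, 49, 46, 42, 34, 38, 30, 37, 6, 28, 32, 1, 4, 26, 7, 3, 8, 9, 2, 10,
    5])],
  [(33, 0, [7, 52, 56, 59, 2, 3, 33, 4, 24, 18, 49, 14, 38, 50, 17, 45, 5, 20, 26, 42, 13, 30, 1,
    19, 32, 22, 9, 16, 21, 28, 6, 23, 8]),
  (31, 0, [30, 51, 49, 57, 4, 58, 15, 2, 48, 41, 45, 50, 3, 11, 6, 7, 20, 10, 14, 43, 23, 21, 16,
    17, 33, 9, 22, 8, 5, 29, 1, 18, 27]),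
  (29, 0, [52, 53, 38, 41, 9, 50, 55, 4, 6, 16, 11, 8, 45, 10, 3, 47, 12, 7, 42, 20, 22, 37, 14,
    33, 35, 2, 24, 26, 19, 34, 5, 1, 13]),
  (27, 0, [9, 57, 10, 53, 11, 38, 5, 50, 44, 51, 41, 39, 42, 35, 7, 8, 4, 1, 26, 14, 21, 18, 20,
    3, 12, 2, 6, 34, 17, 33, 29, 32, 23]),
  (25, 0, [13, 50, 3, 12, 48, 51, 20, 7, 4, 54, 44, 25, 31, 6, 39, 46, 42, 11, 14, 5, 35, 24, 1,
    34, 15, 37, 22, 33, 21, 8, 29, 10, 2]),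
  (9, 7, [49, 45, 51, 52, 48, 46, 36, 32, 37, 35, 44, 25, 38, 7, 5, 41, 1, 26, 4, 29, 27, 2, 9, 6,
    8, 3]),
  (1, 7, [39, 47, 43, 26, 20, 41, 48, 28, 25, 34, 24, 1, 38, 36, 17, 27, 31, 21, 33, 37, 32, 19,
    22, 18, 29, 30])],
  [(33, 0, [4, 1, 3, 7, 10, 2, 13, 22, 40, 48, 39, 20, 51, 32, 36, 50, 46, 47, 38, 19, 5, 16, 17,
    31, 37, 28, 15, 24, 12, 26, 30, 21, 27, 25]),
  (31, 0, [59, 1, 16, 2, 13, 47, 5, 34, 14, 48, 53, 51, 44, 19, 24, 8, 3, 43, 28, 29, 11, 37, 31,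
    41, 12, 4, 39, 7, 17, 25, 20, 30, 10, 18]),
  (29, 0, [58, 61, 57, 47, 51, 5, 2, 7, 32, 10, 6, 25, 1, 19, 42, 46, 8, 43, 9, 27, 29, 13, 15,
    22, 24, 16, 26, 4, 37, 34, 21, 33, 3, 11]),
  (27, 0, [59, 53, 60, 19, 21, 9, 46, 2, 49, 34, 51, 37, 1, 8, 6, 14, 3, 22, 10, 45, 15, 44, 31,
    27, 36, 38, 5, 11, 30, 7, 16, 20, 12, 4]),
  (11, 7, [45, 52, 46, 54, 51, 44, 48, 49, 50, 41, 36, 9, 7, 34, 37, 27, 28, 1, 3, 33, 4, 6, 10,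
    8, 5, 11, 2])],
  [(34, 0, [44, 4, 63, 24, 13, 5, 7, 55, 46, 57, 26, 53, 12, 43, 2, 8, 45, 41, 25, 38, 15, 42, 10,
    32, 1, 22, 3, 6, 18, 23, 30, 19, 16, 34, 11]),
  (32, 0, [58, 1, 12, 2, 16, 23, 11, 60, 44, 55, 47, 13, 37, 48, 49, 38, 5, 10, 4, 19, 40, 27, 20,
    7, 35, 30, 15, 39, 22, 36, 17, 8, 14, 29, 3]),
  (30, 0, [2, 50, 51, 49, 59, 29, 13, 4, 8, 11, 12, 3, 52, 19, 22, 45, 10, 7, 43, 35, 37, 46, 1,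
    42, 32, 34, 17, 39, 21, 33, 14, 9, 5, 25, 16]),
  (28, 0, [42, 1, 56, 5, 60, 2, 3, 52, 45, 53, 55, 43, 25, 44, 8, 9, 19, 15, 16, 14, 7, 10, 22,
    20, 21, 4, 24, 40, 18, 34, 17, 30, 23, 27, 32]),
  (12, 7, [1, 54, 46, 47, 53, 51, 48, 45, 52, 50, 37, 6, 39, 31, 32, 34, 29, 2, 35, 3, 7, 9, 36,
    10, 8, 4, 5, 11])],
  [(36, 0, [57, 11, 9, 3, 63, 5, 8, 17, 52, 26, 35, 54, 51, 56, 41, 6, 24, 29, 40, 47, 7, 23, 1,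
    19, 32, 13, 38, 22, 33, 12, 2, 20, 30, 21, 34, 4]),
  (34, 0, [9, 23, 11, 20, 14, 1, 15, 47, 6, 8, 52, 56, 51, 53, 41, 42, 40, 33, 2, 39, 44, 32, 37,
    45, 3, 26, 4, 19, 16, 36, 30, 38, 29, 12, 5, 7]),
  (32, 0, [57, 58, 23, 6, 3, 40, 9, 42, 56, 14, 32, 5, 8, 48, 55, 2, 50, 17, 37, 7, 1, 47, 43, 18,
    34, 10, 22, 35, 12, 31, 26, 36, 15, 4, 16, 28]),
  (30, 0, [54, 6, 8, 2, 20, 7, 3, 1, 48, 51, 21, 40, 17, 50, 39, 43, 46, 42, 4, 18, 45, 5, 27, 10,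
    44, 23, 19, 25, 15, 38, 34, 24, 29, 36, 32, 22]),
  (14, 7, [1, 57, 51, 56, 52, 50, 54, 55, 53, 42, 44, 39, 37, 35, 33, 8, 41, 2, 3, 6, 14, 31, 5,
    9, 13, 4, 10, 11, 7])]]

theorem tab29_good : goodAll 29 tab29 = true := by
  decide +kernel

/-- Explicit layers for lengths `37` to `44`. -/
def tab37 : List (List Row) := [
  [(37, 0, [58, 27, 7, 1, 59, 5, 65, 10, 24, 53, 17, 55, 4, 23, 42, 25, 49, 50, 51, 45, 9, 18, 28,
    2, 11, 34, 26, 16, 3, 41, 30, 37, 12, 15, 19, 22, 6]),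
  (35, 0, [4, 23, 46, 60, 6, 54, 51, 13, 58, 12, 57, 2, 11, 3, 48, 19, 9, 26, 53, 22, 49, 39, 16,
    32, 44, 5, 10, 31, 33, 35, 21, 15, 7, 37, 18, 30, 1]),
  (33, 0, [11, 18, 48, 59, 47, 60, 6, 61, 7, 45, 17, 5, 51, 4, 50, 10, 42, 1, 2, 40, 25, 3, 27,
    30, 37, 14, 26, 33, 39, 8, 12, 9, 38, 36, 32, 13, 35]),
  (31, 0, [5, 3, 64, 4, 61, 7, 46, 20, 21, 52, 41, 48, 13, 2, 44, 49, 10, 45, 14, 50, 23, 18, 12,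
    1, 39, 25, 42, 22, 26, 27, 6, 24, 15, 34, 37, 35, 17]),
  (29, 0, [3, 66, 59, 5, 9, 23, 6, 62, 8, 61, 11, 40, 41, 35, 36, 34, 38, 39, 4, 1, 22, 42, 49,
    45, 19, 15, 13, 2, 37, 18, 29, 21, 14, 27, 10, 31, 28]),
  (13, 7, [1, 55, 51, 56, 57, 44, 52, 48, 54, 41, 50, 53, 13, 39, 7, 33, 38, 2, 29, 4, 31, 5, 35,
    40, 10, 6, 9, 11, 8, 3])],
  [(37, 0, [67, 59, 1, 15, 35, 49, 65, 12, 16, 6, 41, 3, 47, 8, 48, 42, 56, 10, 11, 51, 53, 9, 13,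
    46, 4, 21, 14, 37, 20, 24, 26, 27, 36, 17, 2, 30, 5, 29]),
  (35, 0, [4, 60, 5, 57, 2, 7, 9, 47, 20, 48, 21, 12, 1, 6, 51, 22, 14, 54, 44, 26, 46, 38, 29,
    45, 24, 39, 3, 28, 42, 40, 43, 15, 31, 25, 18, 37, 13, 30]),
  (33, 0, [20, 46, 67, 59, 69, 2, 12, 10, 42, 50, 29, 4, 1, 57, 47, 6, 18, 5, 9, 48, 40, 27, 49,
    14, 8, 33, 28, 30, 44, 39, 3, 35, 32, 23, 7, 16, 13, 15]),
  (31, 0, [15, 24, 54, 10, 66, 18, 3, 9, 61, 58, 37, 55, 41, 48, 45, 4, 39, 1, 8, 26, 11, 6, 2,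
    42, 36, 47, 38, 21, 43, 44, 33, 5, 14, 25, 34, 7, 16, 12]),
  (15, 7, [2, 59, 61, 62, 53, 56, 58, 48, 54, 37, 39, 55, 41, 46, 42, 43, 5, 7, 4, 8, 34, 31, 14,
    15, 1, 9, 3, 6, 11, 12, 10])],
  [(38, 0, [24, 61, 58, 7, 9, 12, 8, 4, 1, 47, 6, 26, 16, 52, 49, 55, 2, 54, 50, 30, 33, 51, 44,
    38, 34, 19, 10, 25, 27, 45, 3, 11, 35, 42, 5, 29, 23, 36, 31]),
  (36, 0, [69, 13, 70, 10, 12, 22, 4, 8, 43, 47, 53, 42, 56, 49, 45, 11, 44, 3, 6, 2, 51, 40, 1,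
    9, 26, 48, 32, 21, 29, 35, 5, 15, 23, 34, 41, 7, 38, 33, 16]),
  (34, 0, [39, 69, 9, 58, 56, 61, 57, 52, 60, 12, 13, 5, 46, 31, 16, 10, 6, 1, 2, 7, 8, 11, 51,
    49, 40, 42, 17, 19, 41, 21, 45, 3, 23, 18, 28, 14, 4, 37, 33]),
  (32, 0, [5, 72, 63, 38, 34, 10, 4, 60, 66, 13, 2, 49, 25, 7, 50, 28, 59, 32, 51, 52, 3, 23, 11,
    12, 1, 36, 46, 30, 35, 21, 40, 22, 8, 6, 17, 31, 18, 15, 20]),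
  (16, 7, [58, 4, 2, 56, 62, 52, 47, 60, 57, 59, 53, 44, 42, 48, 8, 49, 40, 35, 32, 9, 3, 41, 5,
    11, 36, 1, 6, 12, 7, 14, 10, 13])],
  [(40, 0, [70, 72, 73, 16, 19, 13, 42, 64, 5, 8, 10, 29, 46, 3, 63, 11, 40, 4, 39, 36, 45, 51, 31,
    53, 6, 49, 26, 37, 33, 38, 1, 32, 14, 18, 28, 9, 7, 2, 12, 15]),
  (38, 0, [74, 13, 2, 5, 9, 7, 1, 42, 47, 48, 62, 6, 57, 49, 52, 46, 3, 10, 4, 28, 14, 33, 19, 40,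
    41, 15, 50, 25, 22, 27, 30, 20, 32, 34, 43, 24, 35, 36, 37, 29]),
  (36, 0, [72, 1, 65, 14, 2, 7, 3, 4, 24, 41, 61, 44, 51, 17, 38, 45, 57, 8, 5, 12, 9, 43, 26, 46,
    30, 40, 32, 49, 18, 48, 19, 20, 11, 42, 22, 39, 23, 25, 28, 31]),
  (34, 0, [74, 13, 9, 10, 16, 5, 67, 47, 44, 62, 45, 40, 48, 4, 50, 46, 8, 36, 11, 2, 7, 1, 54,
    52, 23, 34, 12, 38, 49, 20, 37, 41, 3, 6, 22, 27, 32, 29, 19, 30]),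
  (18, 7, [6, 63, 1, 2, 61, 56, 62, 50, 46, 60, 57, 59, 54, 49, 39, 45, 47, 7, 41, 36, 9, 37, 34,
    4, 13, 8, 18, 5, 3, 11, 12, 10, 15])],
  [(41, 0, [17, 77, 60, 39, 1, 5, 12, 16, 3, 6, 58, 48, 40, 36, 57, 4, 50, 7, 29, 11, 59, 8, 45,
    54, 2, 44, 38, 49, 35, 32, 18, 43, 26, 10, 41, 37, 24, 20, 13, 31, 25]),
  (39, 0, [6, 72, 19, 4, 74, 5, 8, 2, 53, 17, 59, 54, 51, 32, 16, 1, 23, 60, 44, 47, 52, 12, 45,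
    29, 27, 28, 33, 7, 48, 35, 24, 15, 26, 9, 3, 22, 39, 42, 36, 21, 31]),
  (37, 0, [11, 2, 68, 62, 6, 64, 53, 30, 66, 12, 40, 1, 67, 28, 5, 60, 36, 22, 17, 58, 3, 55, 24,
    21, 49, 4, 35, 20, 10, 26, 18, 47, 8, 9, 32, 37, 31, 34, 19, 29, 13]),
  (35, 0, [73, 57, 75, 9, 74, 56, 69, 6, 22, 8, 14, 10, 15, 2, 43, 27, 33, 51, 38, 48, 11, 45, 41,
    12, 50, 3, 7, 52, 26, 47, 42, 24, 18, 29, 30, 1, 4, 23, 13, 20, 5]),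
  (33, 0, [69, 67, 4, 13, 55, 65, 50, 26, 66, 12, 16, 43, 17, 6, 24, 61, 1, 47, 40, 5, 57, 45, 15,
    8, 54, 2, 49, 7, 44, 18, 22, 29, 3, 46, 14, 9, 19, 36, 11, 32, 27]),
  (31, 0, [6, 69, 76, 13, 67, 5, 68, 53, 45, 49, 12, 25, 50, 7, 55, 8, 63, 16, 39, 48, 30, 9, 2,
    11, 15, 17, 51, 29, 3, 19, 22, 44, 36, 21, 42, 31, 1, 18, 23, 4, 33]),
  (13, 8, [1, 56, 58, 59, 65, 62, 48, 54, 44, 50, 61, 57, 51, 38, 52, 7, 5, 31, 9, 37, 35, 49, 8,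
    12, 41, 3, 32, 6, 36, 2, 4, 10, 11])],
  [(41, 0, [73, 64, 4, 65, 1, 5, 74, 2, 20, 11, 29, 61, 6, 53, 23, 52, 27, 58, 63, 17, 15, 34, 56,
    35, 38, 26, 3, 18, 19, 21, 44, 25, 12, 30, 45, 7, 28, 16, 8, 37, 31, 36]),
  (39, 0, [49, 67, 79, 3, 74, 57, 52, 13, 5, 68, 50, 6, 45, 63, 1, 18, 7, 55, 26, 28, 11, 16, 58,
    12, 31, 54, 8, 15, 2, 14, 43, 9, 20, 23, 4, 36, 30, 32, 29, 22, 25, 33]),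
  (37, 0, [25, 2, 3, 5, 10, 70, 4, 35, 30, 65, 67, 58, 53, 20, 6, 61, 52, 45, 21, 28, 8, 16, 22,
    55, 57, 54, 47, 44, 36, 1, 15, 27, 40, 23, 26, 11, 31, 33, 17, 13, 19, 39]),
  (35, 0, [35, 27, 60, 17, 61, 62, 10, 57, 53, 1, 9, 63, 59, 2, 7, 3, 54, 55, 50, 15, 6, 12, 5,
    13, 16, 4, 49, 51, 41, 47, 18, 46, 28, 21, 29, 45, 8, 42, 43, 34, 26, 11]),
  (33, 0, [67, 77, 51, 6, 62, 1, 23, 68, 26, 5, 61, 24, 14, 11, 3, 66, 63, 4, 15, 29, 35, 31, 58,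
    53, 22, 49, 44, 17, 40, 32, 42, 8, 9, 36, 16, 7, 41, 19, 27, 12, 20, 2]),
  (15, 8, [2, 61, 1, 63, 64, 58, 59, 57, 62, 48, 51, 60, 11, 40, 41, 39, 43, 7, 38, 54, 49, 4, 50,
    44, 34, 5, 8, 33, 12, 6, 3, 13, 9, 10])],
  [(42, 0, [37, 10, 80, 77, 8, 59, 39, 40, 2, 63, 3, 38, 69, 6, 52, 5, 9, 61, 57, 4, 11, 48, 19, 7,
    50, 18, 30, 44, 1, 54, 22, 46, 31, 25, 36, 26, 32, 42, 13, 28, 20, 21, 12]),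
  (40, 0, [69, 7, 81, 75, 64, 61, 8, 66, 28, 50, 25, 71, 21, 10, 15, 16, 65, 11, 26, 51, 14, 53,
    54, 52, 56, 2, 13, 3, 36, 9, 23, 20, 24, 22, 29, 44, 6, 17, 5, 19, 1, 4, 30]),
  (38, 0, [58, 17, 69, 73, 70, 59, 55, 9, 7, 51, 49, 21, 44, 1, 5, 8, 6, 3, 13, 2, 4, 42, 12, 14,
    46, 56, 10, 52, 29, 33, 50, 47, 43, 16, 48, 15, 32, 30, 45, 34, 37, 31, 11]),
  (36, 0, [5, 1, 69, 28, 7, 21, 67, 73, 53, 70, 8, 2, 31, 10, 56, 33, 48, 50, 60, 23, 57, 11, 12,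
    58, 14, 26, 4, 49, 32, 18, 45, 41, 3, 25, 40, 24, 19, 13, 44, 29, 43, 16, 20]),
  (20, 7, [62, 5, 1, 72, 68, 63, 57, 67, 61, 49, 56, 65, 58, 51, 53, 16, 55, 48, 41, 9, 6, 8, 11,
    50, 36, 2, 10, 7, 4, 12, 13, 18, 3, 15, 19, 20])],
  [(44, 0, [4, 57, 11, 20, 14, 7, 28, 75, 60, 68, 74, 41, 18, 67, 3, 29, 5, 19, 2, 50, 63, 64, 39,
    51, 52, 37, 31, 1, 44, 49, 35, 42, 23, 6, 9, 46, 13, 30, 12, 15, 26, 10, 33, 36]),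
  (42, 0, [10, 8, 6, 80, 74, 54, 75, 25, 69, 16, 19, 38, 40, 61, 68, 30, 2, 58, 15, 60, 23, 3, 45,
    46, 7, 48, 4, 57, 32, 9, 17, 41, 31, 52, 1, 20, 44, 21, 24, 27, 11, 5, 26, 18]),
  (40, 0, [30, 9, 69, 11, 27, 3, 32, 22, 62, 67, 5, 66, 70, 72, 55, 2, 37, 7, 65, 54, 61, 46, 23,
    17, 56, 39, 1, 48, 26, 50, 4, 25, 15, 8, 40, 24, 13, 6, 10, 16, 20, 43, 36, 29]),
  (38, 0, [82, 33, 75, 78, 62, 74, 1, 5, 31, 76, 23, 69, 25, 60, 12, 27, 68, 58, 65, 3, 4, 42, 40,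
    8, 20, 44, 21, 32, 22, 24, 2, 45, 17, 18, 34, 13, 9, 6, 29, 7, 15, 19, 10, 14]),
  (22, 7, [5, 1, 2, 70, 62, 66, 69, 63, 3, 68, 58, 65, 57, 54, 64, 46, 44, 47, 56, 19, 9, 10, 43,
    39, 18, 38, 4, 45, 20, 12, 7, 8, 17, 11, 6, 21, 14])]]

theorem tab37_good : goodAll 37 tab37 = true := by
  decide +kernel

/-- Explicit layers for lengths `45` to `52`. -/
def tab45 : List (List Row) := [
  [(45, 0, [1, 9, 13, 73, 3, 75, 71, 72, 24, 64, 62, 34, 28, 57, 21, 63, 7, 65, 8, 12, 55, 42, 26,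
    4, 61, 25, 18, 22, 6, 33, 16, 2, 20, 41, 32, 29, 51, 47, 45, 17, 15, 40, 23, 43, 10]),
  (43, 0, [11, 1, 76, 9, 71, 28, 77, 55, 78, 17, 27, 7, 8, 56, 35, 45, 3, 18, 4, 40, 12, 59, 65,
    43, 58, 46, 21, 2, 57, 50, 38, 19, 31, 32, 47, 42, 48, 20, 10, 25, 5, 29, 34, 13, 14]),
  (41, 0, [62, 82, 32, 69, 3, 16, 80, 10, 19, 73, 13, 18, 8, 67, 35, 1, 50, 64, 43, 49, 51, 36, 2,
    52, 55, 5, 7, 60, 26, 15, 47, 9, 4, 41, 39, 17, 23, 30, 46, 14, 45, 29, 22, 12, 6]),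
  (39, 0, [82, 10, 41, 48, 17, 5, 75, 70, 50, 58, 2, 4, 29, 73, 3, 64, 52, 68, 9, 1, 18, 11, 20,
    8, 49, 51, 7, 32, 56, 26, 57, 44, 30, 28, 23, 39, 34, 13, 27, 33, 43, 22, 38, 6, 12]),
  (23, 7, [68, 71, 73, 66, 4, 6, 72, 70, 1, 65, 2, 53, 67, 58, 44, 55, 50, 46, 11, 48, 56, 9, 43,
    8, 49, 3, 54, 7, 13, 21, 10, 5, 17, 15, 12, 18, 16, 14]),
  (4, 9, [27, 72, 60, 38, 71, 44, 57, 61, 34, 47, 51, 32, 48, 53, 4, 63, 36, 59, 33, 26, 50, 3,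
    52, 49, 45, 29, 39, 28, 25, 1, 41, 2, 35, 24, 30, 42])],
  [(45, 0, [67, 12, 64, 20, 82, 21, 8, 3, 16, 59, 10, 11, 9, 6, 13, 54, 56, 65, 53, 57, 63, 37, 55,
    41, 5, 50, 36, 61, 19, 60, 4, 34, 22, 15, 39, 49, 7, 2, 32, 42, 40, 44, 45, 1, 35, 29]),
  (43, 0, [79, 87, 74, 15, 9, 4, 37, 78, 12, 16, 72, 67, 18, 46, 59, 19, 64, 52, 5, 2, 57, 3, 50,
    26, 21, 40, 58, 11, 36, 8, 32, 30, 35, 33, 55, 23, 20, 10, 1, 48, 31, 45, 39, 14, 6, 7]),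
  (41, 0, [74, 22, 80, 82, 77, 37, 38, 76, 71, 50, 70, 18, 4, 35, 6, 73, 61, 5, 66, 67, 69, 16,
    34, 12, 47, 25, 2, 9, 21, 3, 28, 8, 23, 7, 13, 29, 15, 31, 49, 14, 1, 19, 10, 11, 17, 30]),
  (39, 0, [86, 9, 13, 84, 4, 64, 71, 68, 54, 62, 41, 44, 10, 48, 67, 6, 8, 3, 23, 15, 5, 63, 57,
    50, 11, 2, 7, 30, 46, 16, 22, 52, 17, 35, 36, 21, 18, 1, 51, 27, 32, 47, 43, 33, 34, 20]),
  (37, 0, [9, 88, 2, 7, 11, 60, 5, 61, 6, 70, 23, 42, 12, 51, 66, 22, 20, 71, 59, 3, 55, 64, 24,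
    25, 35, 48, 1, 54, 44, 16, 33, 21, 46, 53, 27, 4, 47, 34, 32, 30, 36, 17, 45, 39, 10, 29]),
  (21, 7, [69, 7, 61, 68, 1, 4, 76, 72, 59, 65, 60, 70, 66, 67, 48, 58, 44, 51, 18, 45, 55, 6, 9,
    3, 11, 41, 50, 2, 10, 43, 13, 15, 21, 12, 8, 17, 5, 14, 39])],
  [(46, 0, [7, 13, 6, 88, 29, 5, 83, 17, 26, 62, 63, 67, 76, 73, 54, 21, 2, 60, 1, 48, 50, 43, 15,
    32, 61, 10, 27, 56, 53, 25, 52, 31, 19, 9, 4, 30, 24, 8, 3, 51, 35, 33, 34, 44, 36, 16, 20]),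
  (44, 0, [42, 79, 80, 7, 1, 2, 83, 6, 10, 81, 78, 74, 35, 8, 39, 76, 67, 70, 30, 65, 13, 43, 59,
    34, 20, 33, 36, 38, 32, 27, 29, 21, 18, 16, 12, 19, 15, 3, 40, 4, 5, 26, 31, 28, 24, 41, 23]),
  (42, 0, [12, 15, 80, 82, 77, 83, 78, 10, 13, 6, 79, 47, 52, 50, 5, 51, 44, 45, 72, 53, 9, 7, 8,
    42, 2, 55, 31, 27, 17, 57, 3, 24, 35, 28, 36, 1, 14, 22, 18, 38, 4, 11, 29, 26, 39, 46, 41]),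
  (40, 0, [66, 83, 18, 1, 12, 73, 17, 43, 75, 6, 81, 13, 47, 9, 3, 57, 72, 2, 55, 37, 67, 44, 68,
    15, 36, 10, 29, 34, 30, 25, 56, 16, 4, 52, 46, 14, 45, 7, 32, 50, 5, 35, 33, 31, 38, 22, 11]),
  (38, 0, [8, 19, 79, 36, 82, 31, 84, 33, 81, 4, 1, 51, 71, 75, 9, 2, 60, 38, 69, 11, 23, 70, 41,
    49, 18, 48, 53, 57, 3, 32, 55, 37, 28, 5, 20, 29, 22, 45, 14, 7, 10, 16, 6, 26, 30, 25, 13]),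
  (20, 8, [66, 75, 1, 70, 67, 72, 2, 71, 74, 63, 60, 69, 52, 55, 12, 68, 65, 48, 43, 18, 7, 58,
    19, 51, 4, 44, 41, 8, 17, 5, 3, 11, 6, 42, 10, 14, 16, 13, 9])],
  [(48, 0, [2, 23, 72, 76, 1, 27, 77, 73, 12, 75, 25, 41, 26, 74, 71, 3, 65, 69, 21, 14, 10, 5, 7,
    13, 4, 50, 38, 51, 54, 48, 46, 35, 31, 29, 59, 16, 52, 17, 20, 53, 19, 15, 18, 47, 45, 8, 11,
    44]),
  (46, 0, [3, 20, 2, 15, 64, 9, 6, 74, 24, 21, 70, 68, 1, 62, 23, 69, 26, 65, 28, 58, 66, 4, 56,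
    13, 11, 42, 57, 30, 45, 5, 33, 54, 59, 12, 37, 55, 52, 35, 31, 10, 19, 51, 14, 44, 32, 48, 43,
    27]),
  (44, 0, [90, 73, 85, 68, 15, 83, 86, 33, 1, 9, 7, 72, 81, 3, 10, 36, 42, 56, 29, 25, 35, 2, 26,
    43, 38, 5, 63, 49, 57, 4, 12, 60, 11, 24, 50, 32, 39, 17, 40, 41, 30, 31, 8, 6, 16, 18, 19, 14]),
  (42, 0, [5, 89, 90, 85, 46, 27, 73, 75, 8, 1, 3, 7, 16, 80, 41, 68, 19, 4, 47, 35, 10, 52, 55,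
    51, 48, 66, 33, 60, 42, 11, 50, 21, 29, 12, 2, 31, 24, 30, 15, 18, 23, 37, 26, 6, 45, 13, 38,
    28]),
  (40, 0, [50, 74, 83, 28, 7, 17, 42, 69, 85, 78, 11, 4, 77, 70, 76, 48, 64, 3, 10, 65, 5, 37, 1,
    59, 8, 14, 30, 18, 12, 39, 22, 55, 21, 31, 33, 53, 6, 34, 40, 38, 51, 2, 20, 16, 13, 9, 23, 45]),
  (22, 8, [75, 81, 78, 3, 66, 71, 1, 76, 63, 68, 64, 51, 72, 52, 67, 70, 62, 56, 49, 10, 13, 58,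
    12, 8, 48, 5, 6, 11, 40, 20, 17, 14, 16, 2, 9, 7, 21, 4, 15, 22])],
  [(49, 0, [60, 72, 12, 2, 20, 78, 17, 58, 1, 80, 7, 11, 8, 6, 4, 55, 48, 19, 37, 73, 71, 14, 15,
    34, 70, 33, 67, 52, 25, 53, 65, 56, 54, 29, 47, 10, 42, 35, 3, 36, 31, 44, 5, 16, 46, 43, 38,
    30, 32]),
  (47, 0, [4, 25, 56, 88, 64, 81, 7, 87, 32, 11, 31, 70, 73, 29, 1, 16, 77, 78, 33, 61, 10, 68,
    12, 15, 66, 57, 6, 9, 43, 49, 3, 39, 47, 23, 41, 52, 27, 51, 54, 20, 14, 5, 13, 18, 21, 22, 26,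
    2, 28]),
  (45, 0, [34, 31, 23, 11, 5, 10, 4, 74, 69, 79, 70, 76, 16, 20, 62, 68, 66, 77, 72, 67, 17, 71,
    39, 61, 15, 60, 63, 26, 24, 22, 25, 40, 28, 21, 35, 12, 2, 6, 3, 1, 8, 9, 7, 48, 49, 50, 33, 27,
    30]),
  (43, 0, [93, 13, 10, 84, 82, 59, 19, 45, 14, 85, 47, 65, 8, 4, 71, 15, 22, 74, 3, 9, 52, 62, 73,
    23, 64, 48, 11, 55, 28, 33, 5, 40, 7, 57, 20, 30, 38, 31, 46, 27, 35, 36, 37, 49, 6, 2, 17, 12,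
    1]),
  (41, 0, [83, 92, 3, 50, 17, 82, 88, 48, 6, 1, 71, 64, 15, 7, 62, 8, 16, 74, 68, 22, 75, 53, 51,
    39, 2, 41, 4, 21, 26, 23, 38, 5, 37, 32, 11, 28, 20, 43, 54, 46, 19, 10, 47, 29, 33, 12, 44, 35,
    13]),
  (39, 0, [20, 12, 66, 7, 2, 6, 59, 86, 63, 28, 4, 1, 67, 22, 73, 30, 32, 68, 70, 62, 55, 19, 11,
    61, 3, 65, 13, 26, 21, 60, 64, 23, 46, 34, 38, 8, 5, 54, 48, 35, 36, 42, 50, 9, 51, 25, 27, 33,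
    29]),
  (37, 0, [15, 3, 27, 16, 4, 5, 1, 6, 13, 28, 10, 63, 26, 79, 81, 20, 71, 43, 55, 51, 65, 60, 61,
    40, 30, 2, 50, 45, 62, 59, 36, 48, 37, 56, 52, 49, 57, 34, 44, 29, 9, 21, 22, 7, 47, 35, 32, 18,
    46]),
  (19, 8, [1, 4, 65, 71, 74, 59, 70, 62, 58, 73, 55, 75, 72, 57, 69, 18, 64, 60, 63, 68, 11, 8,
    12, 19, 61, 14, 49, 9, 7, 3, 38, 40, 6, 39, 10, 5, 37, 42, 16, 2, 15])],
  [(49, 0, [21, 85, 28, 26, 87, 82, 79, 6, 74, 22, 16, 39, 68, 53, 37, 64, 81, 67, 72, 76, 69, 73,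
    66, 24, 32, 23, 48, 5, 13, 10, 12, 3, 8, 4, 9, 1, 2, 56, 19, 57, 15, 20, 29, 49, 14, 31, 27, 7,
    11, 18]),
  (47, 0, [89, 2, 4, 65, 78, 13, 90, 12, 17, 11, 66, 31, 58, 52, 44, 6, 1, 14, 77, 75, 8, 63, 28,
    68, 57, 18, 26, 70, 19, 20, 49, 61, 9, 27, 59, 42, 33, 30, 34, 36, 16, 37, 38, 3, 39, 43, 5, 40,
    15, 41]),
  (45, 0, [5, 72, 14, 10, 73, 82, 15, 11, 56, 8, 78, 32, 7, 67, 62, 31, 74, 58, 6, 16, 69, 2, 12,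
    3, 1, 13, 53, 35, 43, 57, 36, 51, 40, 26, 33, 60, 24, 48, 59, 18, 52, 55, 19, 41, 37, 49, 4, 44,
    45, 34]),
  (43, 0, [18, 1, 23, 72, 48, 2, 3, 4, 69, 77, 64, 12, 80, 71, 74, 57, 73, 30, 28, 26, 14, 45, 7,
    8, 67, 17, 24, 60, 68, 65, 9, 5, 53, 21, 37, 62, 19, 25, 10, 20, 55, 16, 41, 39, 36, 34, 47, 31,
    42, 32]),
  (41, 0, [13, 7, 2, 83, 88, 75, 71, 40, 80, 32, 87, 76, 82, 1, 6, 31, 77, 78, 73, 43, 30, 23, 26,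
    47, 21, 4, 11, 29, 68, 46, 38, 35, 3, 16, 27, 55, 22, 28, 25, 20, 15, 19, 10, 14, 9, 44, 36, 34,
    37, 5]),
  (23, 8, [9, 68, 2, 78, 73, 74, 72, 4, 76, 67, 79, 77, 75, 55, 57, 14, 66, 69, 54, 13, 65, 52,
    11, 7, 46, 49, 5, 56, 47, 12, 50, 19, 17, 15, 18, 1, 3, 22, 20, 8, 6, 10])],
  [(50, 0, [11, 66, 8, 3, 1, 4, 2, 5, 23, 27, 28, 7, 77, 75, 72, 69, 65, 68, 21, 63, 17, 54, 24, 6,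
    46, 20, 64, 25, 59, 45, 62, 18, 19, 61, 57, 31, 60, 26, 38, 30, 37, 58, 36, 29, 39, 52, 34, 32,
    47, 44, 48]),
  (48, 0, [3, 98, 91, 30, 71, 8, 12, 16, 36, 10, 80, 4, 9, 78, 81, 21, 14, 31, 68, 66, 63, 58, 56,
    59, 57, 55, 72, 42, 69, 32, 13, 35, 28, 38, 5, 6, 11, 20, 18, 24, 33, 29, 50, 15, 44, 39, 26, 2,
    41, 1, 46]),
  (46, 0, [79, 82, 53, 96, 94, 67, 68, 88, 89, 44, 3, 1, 8, 31, 2, 74, 5, 9, 13, 4, 66, 60, 28,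
    29, 72, 21, 33, 12, 49, 65, 6, 11, 41, 55, 32, 34, 22, 10, 19, 15, 36, 7, 38, 39, 23, 26, 14,
    18, 45, 42, 37]),
  (44, 0, [16, 1, 29, 30, 31, 5, 76, 85, 24, 2, 75, 82, 56, 67, 28, 83, 81, 11, 77, 80, 64, 48,
    66, 63, 33, 58, 21, 3, 10, 62, 9, 12, 17, 22, 41, 26, 38, 27, 49, 57, 50, 7, 8, 13, 23, 25, 19,
    4, 18, 40, 44]),
  (42, 0, [1, 91, 86, 18, 57, 94, 89, 47, 40, 6, 3, 20, 14, 71, 26, 68, 64, 69, 33, 72, 10, 73,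
    13, 75, 23, 2, 8, 15, 53, 60, 49, 24, 12, 42, 63, 61, 41, 9, 36, 37, 22, 32, 21, 27, 28, 7, 4,
    11, 45, 29, 16]),
  (40, 0, [3, 1, 2, 17, 12, 28, 19, 72, 27, 30, 74, 67, 87, 78, 63, 4, 77, 15, 69, 71, 62, 9, 38,
    18, 73, 51, 16, 48, 52, 14, 31, 21, 54, 33, 60, 61, 26, 44, 57, 32, 11, 13, 22, 49, 5, 10, 42,
    25, 50, 40, 35]),
  (38, 0, [92, 14, 93, 30, 87, 89, 7, 2, 88, 60, 28, 69, 63, 38, 76, 5, 81, 70, 64, 4, 51, 18, 8,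
    25, 16, 48, 6, 59, 53, 35, 31, 32, 66, 12, 33, 15, 21, 41, 20, 40, 3, 1, 10, 11, 9, 29, 22, 23,
    45, 50, 26]),
  (20, 8, [4, 75, 76, 5, 1, 68, 79, 70, 78, 50, 77, 61, 69, 67, 56, 46, 74, 65, 51, 10, 8, 6, 49,
    12, 9, 7, 42, 48, 60, 54, 59, 43, 52, 58, 11, 19, 15, 13, 14, 2, 3, 38, 18])],
  [(52, 0, [23, 4, 98, 94, 91, 28, 30, 76, 10, 6, 46, 16, 89, 17, 8, 5, 13, 11, 75, 69, 66, 52, 59,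
    57, 55, 14, 51, 48, 50, 47, 44, 38, 35, 65, 58, 61, 2, 62, 25, 21, 1, 29, 49, 7, 20, 39, 36, 12,
    41, 3, 18, 15]),
  (50, 0, [1, 66, 64, 94, 91, 7, 2, 19, 6, 10, 62, 13, 8, 86, 79, 77, 63, 68, 14, 29, 17, 56, 46,
    26, 47, 20, 15, 67, 73, 11, 31, 58, 21, 22, 54, 4, 38, 61, 27, 39, 60, 35, 9, 3, 42, 25, 37, 33,
    48, 32, 34, 40]),
  (48, 0, [12, 92, 1, 89, 18, 28, 85, 90, 86, 9, 17, 58, 41, 63, 82, 53, 19, 55, 13, 51, 54, 52,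
    65, 3, 6, 4, 10, 5, 47, 48, 11, 64, 8, 56, 46, 66, 2, 20, 62, 25, 59, 15, 23, 24, 27, 21, 38,
    43, 50, 14, 29, 32]),
  (46, 0, [16, 12, 97, 8, 96, 78, 76, 68, 19, 36, 11, 3, 85, 83, 4, 51, 1, 32, 2, 48, 13, 27, 63,
    50, 65, 61, 14, 60, 43, 5, 6, 45, 30, 55, 35, 42, 59, 26, 56, 39, 28, 29, 23, 58, 54, 46, 7, 33,
    10, 41, 34, 9]),
  (44, 0, [93, 72, 9, 75, 8, 94, 34, 25, 27, 11, 6, 17, 83, 81, 19, 76, 13, 65, 67, 3, 22, 5, 47,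
    60, 43, 62, 70, 28, 10, 55, 14, 69, 49, 31, 23, 66, 40, 38, 50, 35, 58, 51, 18, 54, 4, 41, 7,
    12, 1, 21, 2, 29]),
  (42, 0, [90, 8, 45, 31, 79, 93, 85, 39, 4, 17, 78, 5, 60, 83, 80, 3, 36, 53, 1, 18, 65, 19, 62,
    57, 63, 72, 2, 6, 15, 33, 24, 61, 69, 11, 35, 7, 9, 29, 10, 25, 55, 59, 40, 34, 27, 54, 21, 26,
    12, 14, 28, 42]),
  (26, 7, [1, 4, 81, 86, 82, 9, 6, 78, 85, 2, 45, 65, 80, 69, 67, 58, 52, 55, 59, 47, 15, 11, 72,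
    8, 54, 62, 64, 53, 60, 50, 3, 7, 5, 51, 57, 10, 14, 26, 19, 13, 24, 18, 20, 17, 21])]]

theorem tab45_good : goodAll 45 tab45 = true := by
  decide +kernel

/-- Explicit layers for lengths `53` to `60`. -/
def tab53 : List (List Row) := [
  [(53, 0, [3, 13, 93, 20, 26, 6, 79, 91, 85, 88, 21, 60, 8, 64, 62, 29, 78, 2, 25, 53, 70, 30, 41,
    4, 72, 66, 74, 19, 39, 11, 9, 57, 51, 69, 65, 22, 5, 32, 14, 40, 38, 1, 17, 12, 10, 28, 36, 33,
    16, 37, 42, 52, 49]),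
  (51, 0, [2, 26, 27, 3, 83, 25, 4, 59, 5, 37, 22, 57, 40, 75, 87, 77, 78, 68, 8, 81, 82, 19, 74,
    67, 11, 61, 12, 1, 9, 47, 63, 13, 66, 18, 16, 45, 46, 38, 53, 58, 21, 28, 23, 60, 51, 15, 43,
    20, 24, 35, 49, 7, 29]),
  (49, 0, [82, 87, 9, 13, 18, 3, 4, 83, 11, 84, 16, 2, 54, 21, 56, 27, 47, 85, 10, 79, 40, 76, 49,
    77, 5, 29, 42, 57, 39, 36, 61, 31, 1, 22, 7, 68, 60, 24, 63, 8, 55, 53, 43, 34, 48, 44, 41, 52,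
    28, 25, 19, 35, 6]),
  (47, 0, [89, 36, 75, 97, 77, 79, 19, 20, 30, 87, 78, 86, 24, 82, 80, 2, 26, 7, 1, 4, 32, 65, 70,
    67, 25, 22, 9, 74, 6, 43, 10, 34, 35, 47, 45, 68, 33, 54, 18, 15, 62, 5, 11, 8, 13, 14, 16, 52,
    12, 49, 37, 17, 3]),
  (31, 7, [1, 7, 83, 85, 8, 5, 67, 2, 3, 4, 82, 80, 77, 6, 64, 60, 63, 73, 76, 58, 62, 75, 61, 72,
    57, 14, 11, 49, 17, 51, 18, 26, 28, 54, 52, 9, 31, 47, 25, 29, 53, 13, 16, 27, 15, 10]),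
  (13, 8, [62, 91, 53, 72, 73, 90, 80, 81, 82, 71, 57, 45, 54, 59, 69, 6, 42, 34, 76, 12, 64, 66,
    41, 1, 2, 60, 65, 11, 7, 8, 35, 9, 4, 13, 10, 39, 3, 44, 55, 37, 31, 32, 40, 46, 5])],
  [(53, 0, [7, 96, 8, 100, 4, 79, 95, 6, 33, 74, 35, 93, 90, 5, 9, 78, 61, 59, 60, 3, 52, 64, 2,
    31, 38, 1, 20, 32, 21, 13, 37, 69, 34, 72, 19, 23, 15, 43, 41, 56, 48, 40, 29, 18, 25, 42, 36,
    51, 16, 24, 44, 39, 47, 10]),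
  (51, 0, [4, 5, 20, 82, 75, 2, 33, 86, 35, 16, 84, 79, 40, 1, 7, 38, 41, 39, 37, 81, 72, 78, 6,
    74, 3, 71, 21, 77, 13, 9, 65, 67, 27, 69, 15, 68, 22, 50, 48, 12, 49, 19, 24, 58, 44, 46, 30,
    36, 14, 23, 34, 54, 17, 28]),
  (49, 0, [1, 7, 85, 4, 29, 17, 89, 95, 84, 21, 32, 28, 57, 69, 80, 78, 61, 6, 60, 8, 77, 42, 10,
    75, 19, 71, 24, 18, 13, 20, 22, 59, 68, 70, 55, 9, 25, 38, 2, 66, 39, 63, 30, 15, 40, 41, 14,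
    23, 51, 52, 33, 3, 16, 35]),
  (47, 0, [17, 85, 93, 76, 84, 87, 60, 3, 44, 37, 4, 34, 8, 5, 1, 9, 32, 15, 11, 12, 71, 75, 31,
    77, 46, 79, 10, 7, 62, 53, 64, 54, 69, 6, 59, 42, 63, 65, 16, 66, 29, 23, 26, 20, 13, 39, 41,
    27, 30, 2, 47, 25, 51, 45]),
  (45, 0, [87, 40, 36, 8, 96, 99, 9, 24, 25, 5, 89, 1, 17, 43, 75, 12, 3, 56, 78, 74, 59, 4, 72,
    55, 2, 57, 54, 7, 69, 52, 58, 53, 14, 34, 67, 10, 21, 68, 39, 22, 63, 28, 20, 47, 32, 41, 26,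
    44, 27, 11, 48, 51, 6, 13]),
  (29, 7, [78, 88, 2, 91, 7, 4, 90, 3, 9, 63, 61, 1, 6, 85, 81, 69, 53, 66, 68, 73, 77, 64, 14,
    52, 49, 65, 62, 54, 16, 8, 10, 45, 50, 58, 12, 13, 25, 56, 27, 24, 19, 46, 26, 17, 5, 11, 18])],
  [(54, 0, [93, 78, 100, 79, 28, 85, 92, 90, 95, 39, 8, 26, 5, 1, 47, 10, 7, 33, 35, 9, 75, 23, 16,
    77, 12, 62, 81, 15, 11, 63, 53, 45, 69, 37, 71, 49, 4, 19, 61, 67, 14, 31, 20, 25, 50, 24, 34,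
    38, 30, 17, 2, 13, 3, 51, 6]),
  (52, 0, [11, 27, 84, 2, 4, 20, 6, 8, 99, 83, 35, 85, 88, 37, 91, 5, 87, 89, 86, 41, 38, 26, 39,
    34, 40, 13, 73, 74, 43, 69, 67, 44, 30, 10, 33, 31, 58, 56, 50, 17, 36, 18, 48, 59, 45, 46, 7,
    1, 3, 28, 22, 23, 21, 25, 14]),
  (50, 0, [92, 16, 13, 20, 31, 5, 2, 99, 56, 95, 57, 78, 87, 37, 91, 61, 74, 4, 85, 7, 9, 73, 79,
    77, 36, 43, 52, 58, 35, 1, 47, 24, 17, 18, 6, 3, 66, 22, 8, 41, 26, 15, 65, 28, 38, 48, 40, 49,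
    10, 23, 29, 46, 32, 45, 11]),
  (48, 0, [23, 10, 7, 5, 29, 85, 101, 17, 2, 3, 82, 88, 8, 75, 33, 6, 56, 32, 18, 31, 19, 1, 48,
    44, 45, 55, 68, 39, 77, 47, 72, 69, 57, 4, 59, 50, 60, 58, 66, 62, 63, 46, 35, 20, 42, 61, 52,
    36, 34, 30, 11, 9, 22, 38, 21]),
  (32, 7, [7, 86, 81, 2, 82, 8, 89, 84, 85, 11, 78, 87, 3, 77, 4, 1, 63, 64, 59, 61, 69, 21, 19,
    17, 70, 57, 71, 72, 56, 67, 9, 13, 68, 10, 20, 12, 28, 48, 25, 30, 32, 14, 23, 49, 5, 6, 22,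
    15])],
  [(56, 0, [21, 15, 28, 97, 10, 24, 76, 19, 23, 13, 17, 95, 39, 36, 91, 66, 82, 71, 72, 70, 75, 81,
    74, 29, 73, 12, 83, 7, 80, 4, 45, 16, 42, 68, 46, 64, 27, 11, 69, 65, 43, 44, 14, 2, 50, 47, 40,
    3, 9, 6, 8, 22, 32, 1, 5, 48]),
  (54, 0, [79, 4, 65, 93, 8, 28, 10, 12, 75, 13, 5, 84, 14, 94, 11, 85, 78, 81, 2, 57, 86, 52, 17,
    61, 31, 41, 73, 27, 36, 21, 32, 72, 6, 39, 44, 1, 69, 15, 18, 63, 51, 22, 7, 3, 64, 25, 46, 62,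
    45, 48, 38, 34, 35, 33, 47, 49]),
  (52, 0, [29, 2, 105, 16, 5, 40, 1, 74, 27, 73, 64, 89, 92, 21, 6, 28, 70, 4, 88, 3, 18, 87, 8,
    68, 75, 17, 20, 69, 45, 43, 10, 56, 48, 35, 71, 58, 61, 57, 60, 19, 55, 51, 36, 32, 59, 14, 15,
    30, 31, 41, 52, 12, 37, 9, 22, 54]),
  (50, 0, [103, 78, 40, 101, 104, 91, 96, 94, 4, 72, 19, 2, 74, 82, 80, 52, 5, 47, 1, 8, 21, 9,
    12, 35, 28, 57, 79, 6, 60, 55, 10, 30, 48, 13, 15, 20, 14, 22, 69, 32, 29, 42, 64, 66, 41, 27,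
    43, 26, 18, 49, 7, 3, 11, 24, 39, 36]),
  (34, 7, [84, 7, 8, 82, 83, 4, 93, 85, 6, 86, 3, 70, 77, 89, 80, 2, 74, 5, 1, 61, 76, 27, 78, 60,
    55, 73, 15, 64, 29, 10, 31, 12, 56, 53, 26, 17, 65, 9, 13, 58, 16, 14, 51, 34, 32, 23, 18, 11,
    22])],
  [(57, 0, [5, 25, 91, 70, 86, 12, 101, 96, 67, 93, 48, 23, 82, 20, 81, 28, 6, 88, 53, 1, 7, 18,
    13, 22, 84, 36, 78, 73, 19, 59, 80, 68, 74, 29, 16, 33, 45, 15, 2, 3, 8, 60, 41, 14, 35, 27, 50,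
    64, 11, 4, 17, 40, 34, 32, 55, 10, 42]),
  (55, 0, [8, 17, 96, 93, 6, 2, 34, 9, 50, 35, 23, 3, 85, 88, 80, 87, 39, 40, 77, 41, 84, 79, 81,
    70, 30, 4, 1, 24, 25, 19, 76, 7, 78, 38, 29, 43, 5, 68, 53, 51, 46, 47, 69, 27, 65, 63, 10, 15,
    21, 36, 49, 28, 16, 54, 13, 32, 26]),
  (53, 0, [99, 89, 106, 21, 97, 32, 101, 26, 11, 57, 22, 71, 56, 96, 92, 81, 10, 66, 51, 4, 53, 6,
    67, 2, 33, 80, 13, 3, 83, 12, 1, 79, 46, 48, 50, 8, 9, 63, 18, 59, 40, 19, 44, 15, 7, 25, 58,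
    24, 39, 16, 14, 52, 42, 38, 20, 17, 5]),
  (51, 0, [62, 64, 101, 81, 9, 13, 92, 12, 98, 8, 1, 46, 93, 3, 90, 85, 10, 6, 84, 74, 5, 14, 25,
    45, 40, 4, 24, 42, 79, 47, 43, 60, 76, 34, 32, 75, 16, 18, 2, 53, 50, 37, 57, 31, 19, 38, 49, 7,
    63, 36, 11, 28, 35, 48, 55, 41, 26]),
  (49, 0, [61, 96, 100, 1, 59, 60, 16, 53, 90, 82, 98, 10, 4, 88, 89, 80, 9, 17, 30, 5, 91, 6, 15,
    19, 83, 81, 24, 13, 76, 7, 63, 43, 48, 35, 49, 3, 45, 27, 62, 36, 12, 32, 11, 66, 22, 2, 21, 58,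
    23, 33, 39, 18, 47, 37, 34, 55, 14]),
  (31, 8, [6, 89, 3, 4, 5, 91, 8, 73, 90, 76, 82, 70, 74, 71, 81, 79, 85, 1, 22, 63, 69, 67, 23,
    80, 75, 77, 65, 66, 20, 9, 53, 13, 7, 10, 12, 62, 11, 15, 49, 61, 2, 25, 14, 31, 16, 27, 29, 24,
    28]),
  (13, 8, [55, 76, 85, 80, 75, 79, 13, 68, 78, 93, 43, 60, 40, 81, 86, 42, 6, 9, 72, 70, 3, 8, 2,
    47, 73, 7, 77, 49, 5, 33, 12, 61, 50, 39, 59, 66, 62, 48, 53, 57, 4, 10, 46, 37, 51, 1, 32, 52,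
    11])],
  [],
  [(58, 0, [105, 113, 48, 110, 27, 85, 26, 87, 89, 8, 79, 24, 4, 78, 97, 88, 2, 83, 92, 7, 82, 31,
    12, 13, 9, 15, 42, 65, 41, 58, 17, 45, 32, 34, 52, 77, 23, 62, 57, 3, 64, 74, 29, 19, 33, 1, 5,
    10, 18, 14, 6, 47, 28, 43, 11, 53, 16, 25, 49]),
  (56, 0, [14, 19, 71, 109, 7, 105, 16, 11, 83, 88, 61, 13, 36, 91, 89, 87, 3, 37, 80, 21, 68, 39,
    72, 5, 56, 25, 1, 86, 17, 30, 76, 59, 10, 29, 73, 79, 38, 74, 27, 70, 41, 8, 2, 4, 34, 6, 50,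
    45, 60, 12, 43, 35, 47, 62, 9, 40, 33, 20, 42]),
  (54, 0, [15, 99, 28, 112, 78, 80, 12, 71, 51, 103, 11, 93, 2, 97, 57, 43, 1, 5, 85, 83, 8, 84,
    10, 3, 72, 35, 88, 27, 29, 23, 20, 7, 77, 68, 41, 14, 33, 46, 52, 74, 6, 24, 49, 45, 17, 66, 31,
    39, 59, 38, 13, 47, 4, 44, 40, 37, 16, 9, 48]),
  (38, 7, [94, 95, 13, 10, 99, 84, 18, 1, 78, 93, 6, 11, 92, 77, 5, 83, 89, 82, 2, 73, 80, 4, 85,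
    57, 3, 54, 61, 64, 67, 68, 15, 16, 28, 60, 72, 23, 12, 7, 37, 62, 25, 14, 22, 65, 8, 32, 17, 29,
    20, 21, 9, 34]),
  (20, 8, [74, 3, 1, 103, 43, 77, 79, 93, 18, 89, 80, 90, 67, 81, 85, 73, 87, 66, 48, 11, 82, 75,
    50, 9, 5, 61, 2, 57, 52, 4, 46, 8, 39, 60, 53, 72, 17, 55, 20, 13, 19, 10, 47, 54, 6, 12, 49,
    58, 56, 7, 14])],
  []]

theorem tab53_good : goodAll 53 tab53 = true := by
  decide +kernel

/-- Explicit layers for lengths `61` to `68`. -/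
def tab61 : List (List Row) := [
  [(61, 0, [114, 65, 24, 109, 91, 28, 88, 6, 9, 68, 93, 23, 101, 2, 16, 89, 49, 102, 60, 8, 48, 79,
    7, 94, 77, 12, 10, 36, 39, 51, 78, 11, 20, 5, 58, 4, 80, 54, 73, 76, 1, 55, 15, 50, 27, 3, 53,
    13, 14, 57, 59, 32, 18, 35, 25, 63, 26, 29, 44, 22, 47]),
  (59, 0, [7, 23, 71, 97, 9, 18, 65, 8, 4, 85, 12, 6, 51, 72, 66, 101, 92, 1, 20, 14, 99, 15, 96,
    87, 3, 86, 70, 74, 81, 73, 61, 59, 13, 10, 30, 24, 29, 2, 36, 33, 35, 5, 64, 44, 32, 34, 38, 39,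
    41, 55, 53, 62, 46, 25, 45, 52, 58, 48, 54, 56, 57]),
  (57, 0, [98, 103, 7, 113, 8, 17, 21, 96, 94, 91, 9, 18, 3, 10, 24, 15, 5, 90, 28, 55, 60, 44,
    83, 59, 36, 46, 11, 92, 87, 88, 67, 37, 35, 79, 43, 38, 40, 6, 32, 39, 73, 52, 20, 68, 51, 4,
    45, 61, 48, 57, 2, 63, 49, 65, 12, 30, 54, 1, 14, 22, 29]),
  (55, 0, [101, 108, 40, 11, 9, 10, 80, 86, 92, 2, 14, 107, 42, 6, 4, 91, 82, 75, 93, 16, 71, 12,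
    38, 67, 7, 41, 68, 5, 88, 85, 66, 43, 47, 26, 31, 21, 13, 73, 74, 1, 8, 20, 57, 25, 33, 30, 27,
    3, 24, 34, 45, 29, 50, 32, 59, 62, 51, 48, 61, 49, 55]),
  (53, 0, [9, 114, 8, 90, 3, 29, 35, 107, 84, 102, 26, 79, 69, 72, 7, 103, 4, 16, 86, 20, 17, 33,
    5, 1, 39, 15, 63, 61, 2, 47, 22, 76, 64, 62, 82, 49, 83, 68, 71, 78, 60, 36, 52, 27, 18, 10, 51,
    55, 23, 42, 19, 32, 21, 48, 12, 6, 57, 30, 50, 53, 46]),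
  (51, 0, [27, 37, 4, 96, 64, 76, 3, 15, 92, 9, 7, 20, 68, 40, 80, 5, 38, 8, 25, 90, 83, 28, 6,
    94, 89, 91, 41, 14, 1, 81, 17, 73, 50, 74, 78, 43, 75, 59, 12, 62, 19, 65, 77, 48, 61, 11, 69,
    67, 18, 49, 2, 44, 66, 55, 30, 34, 46, 36, 39, 16, 23]),
  (35, 7, [1, 7, 3, 9, 10, 8, 88, 103, 85, 6, 75, 73, 92, 11, 4, 90, 71, 84, 94, 76, 86, 67, 77,
    18, 65, 82, 27, 55, 14, 80, 72, 15, 13, 58, 66, 61, 32, 30, 59, 51, 63, 22, 17, 68, 54, 33, 62,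
    2, 28, 31, 20, 21, 34, 5])],
  [],
  [(62, 0, [46, 59, 114, 117, 8, 5, 112, 90, 113, 108, 4, 77, 7, 41, 97, 104, 83, 68, 12, 3, 86,
    102, 22, 99, 25, 40, 13, 47, 30, 21, 73, 9, 29, 51, 56, 67, 71, 75, 15, 76, 1, 37, 49, 32, 39,
    6, 24, 10, 66, 19, 31, 36, 28, 52, 2, 11, 20, 35, 38, 42, 17, 33, 27]),
  (60, 0, [19, 104, 110, 9, 7, 17, 103, 45, 106, 108, 44, 105, 91, 4, 41, 92, 42, 39, 12, 94, 101,
    90, 43, 1, 2, 83, 89, 65, 67, 18, 36, 33, 13, 63, 55, 8, 38, 40, 53, 37, 35, 3, 52, 77, 6, 73,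
    76, 72, 5, 32, 20, 11, 46, 14, 24, 29, 27, 25, 22, 64, 50, 10, 31]),
  (58, 0, [37, 40, 116, 86, 84, 89, 9, 1, 85, 82, 88, 90, 6, 104, 78, 107, 67, 10, 3, 7, 5, 33,
    13, 11, 34, 83, 2, 79, 17, 23, 16, 76, 27, 14, 15, 8, 75, 73, 18, 74, 20, 24, 48, 71, 43, 54,
    70, 26, 72, 28, 46, 68, 52, 4, 55, 21, 65, 66, 57, 36, 42, 44, 35]),
  (42, 7, [9, 3, 104, 94, 2, 8, 68, 1, 11, 101, 10, 91, 99, 13, 86, 98, 7, 87, 80, 97, 89, 73, 90,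
    72, 83, 4, 79, 69, 27, 70, 18, 25, 21, 82, 26, 32, 65, 33, 76, 42, 12, 62, 5, 23, 6, 28, 38, 16,
    60, 36, 14, 41, 39, 29, 35, 22]),
  (24, 8, [4, 42, 10, 87, 89, 84, 3, 52, 100, 2, 86, 68, 90, 97, 77, 92, 76, 78, 81, 95, 80, 82,
    9, 63, 85, 7, 8, 14, 83, 6, 51, 19, 66, 11, 48, 69, 17, 57, 49, 45, 18, 72, 20, 54, 61, 1, 60,
    5, 67, 12, 13, 50, 15, 59, 22])],
  [],
  [],
  [],
  [],
  [(56, 7, [119, 114, 105, 21, 107, 20, 11, 109, 19, 22, 10, 106, 2, 9, 1, 4, 86, 92, 17, 85, 13,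
    100, 98, 102, 81, 87, 84, 91, 96, 3, 53, 83, 6, 7, 52, 47, 90, 8, 40, 5, 82, 72, 23, 54, 79, 24,
    18, 15, 29, 39, 16, 12, 48, 14, 45, 37, 50, 27, 32, 34, 41])]]

theorem tab61_good : goodAll 61 tab61 = true := by
  decide +kernel

theorem small_cover {m k : ℕ} (hm : 5 ≤ m) (hm' : m < 69) (hk : k ≤ m + 1) (ha : Adm m k) :
    Covered m k := by
  by_cases h13 : m < 13
  · exact goodAll_sound tab5 5 tab5_good m k (by omega) (lt_of_lt_of_eq h13 rfl) hk ha
  by_cases h21 : m < 21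
  · exact goodAll_sound tab13 13 tab13_good m k (by omega) (lt_of_lt_of_eq h21 rfl) hk ha
  by_cases h29 : m < 29
  · exact goodAll_sound tab21 21 tab21_good m k (by omega) (lt_of_lt_of_eq h29 rfl) hk ha
  by_cases h37 : m < 37
  · exact goodAll_sound tab29 29 tab29_good m k (by omega) (lt_of_lt_of_eq h37 rfl) hk ha
  by_cases h45 : m < 45
  · exact goodAll_sound tab37 37 tab37_good m k (by omega) (lt_of_lt_of_eq h45 rfl) hk ha
  by_cases h53 : m < 53
  · exact goodAll_sound tab45 45 tab45_good m k (by omega) (lt_of_lt_of_eq h53 rfl) hk ha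
  by_cases h61 : m < 61
  · exact goodAll_sound tab53 53 tab53_good m k (by omega) (lt_of_lt_of_eq h61 rfl) hk ha
  by_cases h69 : m < 69
  · exact goodAll_sound tab61 61 tab61_good m k (by omega) (lt_of_lt_of_eq h69 rfl) hk ha
  exact absurd hm' h69

theorem adm_ext (m : ℕ) : ∀ k, Adm m k → ExtLangford 4 m k := by
  induction m using Nat.strong_induction_on with
  | _ m ih =>
    have half : ∀ k, k ≤ m + 1 → Adm m k → ExtLangford 4 m k := by
      intro k hk ha
      refine Covered.ext ?_ ih
      by_cases hm : 69 ≤ m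
      · exact big_cover hm hk ha
      · refine small_cover ?_ (by omega) hk ha
        have := ha.2.2
        omega
    intro k ha
    by_cases hk : k ≤ m + 1
    · exact half k hk ha
    · obtain ⟨⟨h3, h4⟩, h5, h6⟩ := ha
      refine reversal (k := 2 * m + 2 - k) (half _ (by omega) ?_) (by omega) (by omega) h3
      exact ⟨⟨by omega, by omega⟩, by omega, by omega⟩

theorem langford_existence (m k : ℕ) (hm : 5 ≤ m) (hk1 : 1 ≤ k)
    (hk2 : k ≤ 2 * m + 1)
    (hlow : (m : ℤ) * (7 - m) ≤ 2 * ((k : ℤ) - 1))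
    (hhigh : 2 * ((k : ℤ) - 1) ≤ (m : ℤ) * ((m : ℤ) - 3))
    (hres : (m % 4 = 0 ∧ k % 2 = 1) ∨ (m % 4 = 1 ∧ k % 2 = 0) ∨
      (m % 4 = 2 ∧ k % 2 = 0) ∨ (m % 4 = 3 ∧ k % 2 = 1)) :
    ExtLangford 4 m k := by
  apply adm_ext
  refine ⟨⟨hk1, hk2⟩, by omega, ?_⟩
  by_cases h7 : 7 ≤ m
  · exact Or.inl h7
  · have h56 : m = 5 ∨ m = 6 := by omega
    rcases h56 with rfl | rfl
    · push_cast at hlow hhigh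
      omega
    · push_cast at hlow hhigh
      omega
end

section
/- There exists an ASMS(21); that is, there is a magic square of order 21 whose entries are the 441 consecutive integers −220, −219, ..., 219, 220 and which, for every integer k with 3 ≤ k ≤ 19, contains a contiguous k×k submatrix that is a GMS(k). -/
/-- A general magic square of order `n` with magic number `s`: all row sums,
column sums, the main diagonal sum and the back diagonal sum equal `s`. -/
def IsGMS {n : ℕ} (A : Matrix (Fin n) (Fin n) ℤ) (s : ℤ) : Prop :=
  (∀ i, ∑ j, A i j = s) ∧ (∀ j, ∑ i, A i j = s) ∧
  (∑ i, A i i = s) ∧ (∑ i : Fin n, A i i.rev = s)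

/-- `A` contains a contiguous `k × k` submatrix which is a general magic square. -/
def HasSubGMS {n : ℕ} (A : Matrix (Fin n) (Fin n) ℤ) (k : ℕ) : Prop :=
  ∃ i0 j0 : ℕ, ∃ _h1 : i0 + k ≤ n, ∃ _h2 : j0 + k ≤ n, ∃ s : ℤ,
    IsGMS (Matrix.of fun p q : Fin k =>
      A ⟨i0 + p.val, by have := p.isLt; omega⟩ ⟨j0 + q.val, by have := q.isLt; omega⟩) s

/-- The rows of the explicit square. -/
def asmsRows : List (List ℤ) :=
  [[77, -99, 195, 51, -88, -197, -218, 173, 16, 113, 118, -167, -157, 175, 217, -182, -125, 98, -129, 36, 93],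
   [99, -77, -195, -51, 88, 197, 218, -173, -16, -113, -118, 167, 157, -175, -217, 182, 125, -98, 129, -36, -93],
   [-203, 203, -192, -9, -202, -186, 205, 114, 147, 102, 105, 140, -174, -213, 219, -31, 30, -55, 86, 44, -130],
   [148, -148, 9, 192, 202, 186, -205, -114, -147, -102, -105, -140, 174, 213, -219, 31, -30, 55, -86, -44, 130],
   [177, -177, 122, -122, -90, -141, -162, 142, 190, -96, 172, -165, 111, -47, 135, -67, 75, -57, 103, 43, -146],
   [-188, 188, -127, 127, 141, 90, 162, -142, -190, 96, -172, 165, -111, 47, -135, 67, -75, 57, -103, -43, 146],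
   [211, -211, -206, 206, 144, -144, -145, 210, -214, -194, 187, 54, 136, 45, -101, -15, -152, 189, 100, 28, -128],
   [95, -95, 115, -115, 120, -120, -210, 145, 214, 194, -187, -54, -136, -45, 101, 15, 152, -189, -100, -28, 128],
   [-185, 185, -35, 35, -207, 207, 179, -179, -10, 41, -76, 220, 42, 212, -155, -158, -87, -29, 58, 48, -106],
   [123, -123, 216, -216, -12, 12, -24, 24, -41, 10, 76, -220, -42, -212, 155, 158, 87, 29, -58, -48, 106],
   [160, -160, -116, 116, -184, 184, -89, 89, 108, -108, 178, -63, -70, 126, -94, -138, -22, 83, -23, 5, 18],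
   [49, -49, 159, -159, -196, 196, 199, -199, 21, -21, 63, -178, 70, -126, 94, 138, 22, -83, 23, -5, -18],
   [-110, 110, -13, 13, -143, 143, 215, -215, -117, 117, 176, -176, 17, 170, -7, -164, 53, -69, -11, 61, -50],
   [-132, 132, 150, -150, 171, -171, -198, 198, -97, 97, -180, 180, -170, -17, 7, 164, -53, 69, 11, -61, 50],
   [183, -183, 193, -193, -163, 163, -46, 46, -27, 27, -133, 133, 156, -156, 19, 85, 33, -137, 124, -56, -68],
   [-204, 204, -153, 153, 139, -139, -208, 208, -200, 200, -92, 92, 168, -168, -60, -32, 72, 20, -124, 56, 68],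
   [-181, 181, -201, 201, 131, -131, 166, -166, 209, -209, -26, 26, -134, 134, -25, -1, -39, 65, -78, 169, -91],
   [-119, 119, 79, -79, 149, -149, 161, -161, 154, -154, 14, -14, -37, 37, 66, -52, -66, 52, 78, -169, 91],
   [34, -34, 59, -59, 112, -112, 151, -151, -82, 82, 40, -40, 84, -84, -20, 60, 32, -72, -6, 4, 2],
   [73, -73, -121, 121, -38, 38, -71, 71, -109, 109, 64, -64, -81, 81, 39, 25, 1, -65, 8, 0, -8],
   [-107, 107, 62, -62, -74, 74, -80, 80, 191, -191, -104, 104, -3, 3, -19, -85, -33, 137, -2, -4, 6]]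

/-- The entries of the explicit square. -/
def asmsEntry (i j : Fin 21) : ℤ := (asmsRows.getD i.val []).getD j.val 0

/-- The explicit square as a matrix. -/
def asmsMat : Matrix (Fin 21) (Fin 21) ℤ :=
  fun i j => asmsEntry i j

theorem asmsMat_bounds : ∀ i j : Fin 21, -220 ≤ asmsEntry i j ∧ asmsEntry i j ≤ 220 := by
  decide +kernel

theorem asmsMat_surj : ∀ v : Fin 441, ∃ i j : Fin 21, asmsEntry i j = (v.val : ℤ) - 220 := by
  decide +kernel

theorem asmsMat_image :
    Finset.univ.image (fun p : Fin 21 × Fin 21 => asmsMat p.1 p.2) = Finset.Icc (-220 : ℤ) 220 := by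
  ext v
  simp only [Finset.mem_image, Finset.mem_univ, true_and, Finset.mem_Icc, Prod.exists]
  constructor
  · rintro ⟨i, j, rfl⟩
    exact asmsMat_bounds i j
  · rintro ⟨h1, h2⟩
    obtain ⟨i, j, h⟩ := asmsMat_surj ⟨(v + 220).toNat, by omega⟩
    refine ⟨i, j, ?_⟩
    change asmsEntry i j = v
    rw [h]
    simp only
    omega

theorem asms21_exists :
    ∃ A : Matrix (Fin 21) (Fin 21) ℤ,
      (∃ s, IsGMS A s) ∧
      Function.Injective (fun p : Fin 21 × Fin 21 => A p.1 p.2) ∧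
      Set.range (fun p : Fin 21 × Fin 21 => A p.1 p.2) = Set.Icc (-220 : ℤ) 220 ∧
      ∀ k : ℕ, 3 ≤ k → k ≤ 19 → HasSubGMS A k := by
  refine ⟨asmsMat, ⟨0, by unfold IsGMS; decide +kernel⟩, ?_, ?_, ?_⟩
  · have h : (Finset.univ.image (fun p : Fin 21 × Fin 21 => asmsMat p.1 p.2)).card =
        (Finset.univ : Finset (Fin 21 × Fin 21)).card := by
      rw [asmsMat_image]
      simp
    have h' := Finset.card_image_iff.mp h
    rw [Finset.coe_univ] at h'
    exact Set.injOn_univ.mp h'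
  · have h := congrArg (fun s : Finset ℤ => (s : Set ℤ)) asmsMat_image
    simpa using h
  · intro k h3 h19
    interval_cases k
    · exact ⟨18, 18, by norm_num, by norm_num, 0, by unfold IsGMS; decide +kernel⟩
    · exact ⟨14, 14, by norm_num, by norm_num, 0, by unfold IsGMS; decide +kernel⟩
    · exact ⟨15, 11, by norm_num, by norm_num, 0, by unfold IsGMS; decide +kernel⟩
    · exact ⟨12, 12, by norm_num, by norm_num, 0, by unfold IsGMS; decide +kernel⟩
    · exact ⟨14, 14, by norm_num, by norm_num, 0, by unfold IsGMS; decide +kernel⟩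
    · exact ⟨10, 10, by norm_num, by norm_num, 0, by unfold IsGMS; decide +kernel⟩
    · exact ⟨12, 12, by norm_num, by norm_num, 0, by unfold IsGMS; decide +kernel⟩
    · exact ⟨8, 8, by norm_num, by norm_num, 0, by unfold IsGMS; decide +kernel⟩
    · exact ⟨10, 10, by norm_num, by norm_num, 0, by unfold IsGMS; decide +kernel⟩
    · exact ⟨6, 6, by norm_num, by norm_num, 0, by unfold IsGMS; decide +kernel⟩
    · exact ⟨8, 8, by norm_num, by norm_num, 0, by unfold IsGMS; decide +kernel⟩
    · exact ⟨4, 4, by norm_num, by norm_num, 0, by unfold IsGMS; decide +kernel⟩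
    · exact ⟨6, 6, by norm_num, by norm_num, 0, by unfold IsGMS; decide +kernel⟩
    · exact ⟨2, 2, by norm_num, by norm_num, 0, by unfold IsGMS; decide +kernel⟩
    · exact ⟨4, 4, by norm_num, by norm_num, 0, by unfold IsGMS; decide +kernel⟩
    · exact ⟨0, 0, by norm_num, by norm_num, 0, by unfold IsGMS; decide +kernel⟩
    · exact ⟨2, 2, by norm_num, by norm_num, 0, by unfold IsGMS; decide +kernel⟩
end
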